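/- arXiv:2504.19544 — 6 statements merged into one kernel-verified Lean document; each statement's English description precedes it below -/
import Mathlib

section
/- Let I be a decreasing family of finsets of Fin m with r = max_{T ∈ I} |T| and {m−1} ∈ I. Let μ satisfy m − r ≥ μ and r ≥ μ ≥ 3, and set w_μ = 2^{m+1−r} − 2^{m+1−r−μ}. Suppose P is a Boolean function with P ∈ C(I), w(P) = w_μ, and P = (∏_{k=1}^{r−μ} y_k) · (∏_{k=r−μ+1}^{r} y_k + ∏_{k=r+1}^{r+μ} y_k) for some independent family of affine forms y_1, …, y_{r+μ}. Then one of the following holds. (A) There exist S_f, S_g ∈ I_r and S_h ∈ I_{r−μ} with S_h ⊆ S_f ∩ S_g such that P ∈ LTA(m,2)_{S_h}·x^{S_h} · (LTA(m,2)_{S_f}·x^{S_f\S_h} + LTA(m,2)_{S_g}·x^{S_g\S_h}), and moreover either (A.1) S_h = S_f ∩ S_g, or (A.2) S_{h*} := (S_f ∩ S_g) \ S_h is nonempty and there exists a finset S* ⊆ Fin m \ (S_f ∪ S_g) with S* ≺_sh S_{h*}. (B) There exist a finset S_f ∉ I with |S_f| = r, a set S_h ∈ I_{r−μ} with S_h ⊆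 S_f, an element H ∈ LTA(m,2)_{S_h}·x^{S_h}, and pairs (B,ε), (B′,ε′) ∈ LTA(m,2)_{S_f} such that P = H · ((B,ε)·x^{S_f\S_h} + (B′,ε′)·x^{S_f\S_h}); B i j = B′ i j for every i ∈ S_f and every j < i with j ∉ S_f and (S_f \ {i}) ∪ {j} ∉ I; and there exists a finset S* ⊆ Fin m \ S_f with S* ≺_sh S_f \ S_h. -/
open Pointwise

/-- Boolean functions in `m` variables. -/
abbrev BF (m : ℕ) := (Fin m → ZMod 2) → ZMod 2

/-- The monomial `x^S`. -/
def mono {m : ℕ} (S : Finset (Fin m)) : BF m := fun v => ∏ i ∈ S, v i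

/-- Hamming weight of a Boolean function. -/
def wt {m : ℕ} (F : BF m) : ℕ := (Finset.univ.filter fun v => F v = 1).card

/-- The action of an affine pair `(B, ε)` on the monomial `x^T`. -/
def act {m : ℕ} (B : Fin m → Fin m → ZMod 2) (ε : Fin m → ZMod 2)
    (T : Finset (Fin m)) : BF m :=
  fun v => ∏ i ∈ T, (v i + (∑ j, B i j * v j) + ε i)

/-- The orbit `LTA(m,2)·x^S` of the monomial `x^S` under the full lower
triangular affine group. -/
def orbitFull {m : ℕ} (S : Finset (Fin m)) : Set (BF m) :=
  { F | ∃ B : Fin m → Fin m → ZMod 2, ∃ ε : Fin m → ZMod 2,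
      (∀ i j : Fin m, B i j ≠ 0 → j < i) ∧ F = act B ε S }

/-- The subgroup `LTA(m,2)_S`, as a set of pairs `(B, ε)`. -/
def LTAsub {m : ℕ} (S : Finset (Fin m)) :
    Set ((Fin m → Fin m → ZMod 2) × (Fin m → ZMod 2)) :=
  { p | (∀ i, i ∉ S → p.2 i = 0) ∧ ∀ i j, p.1 i j ≠ 0 → i ∈ S ∧ j < i ∧ j ∉ S }

/-- The orbit `LTA(m,2)_S·x^T`. -/
def orbitSub {m : ℕ} (S T : Finset (Fin m)) : Set (BF m) :=
  { F | ∃ p ∈ LTAsub S, F = act p.1 p.2 T }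

/-- `S ≼_sh T`. -/
def shLE {m : ℕ} (S T : Finset (Fin m)) : Prop :=
  ∃ h : S.card = T.card, ∀ ℓ : Fin S.card,
    S.orderEmbOfFin rfl ℓ ≤ T.orderEmbOfFin h.symm ℓ

/-- `S ≺_sh T`. -/
def shLT {m : ℕ} (S T : Finset (Fin m)) : Prop :=
  ∃ h : S.card = T.card, ∀ ℓ : Fin S.card,
    S.orderEmbOfFin rfl ℓ < T.orderEmbOfFin h.symm ℓ

/-- `S ≼ T`. -/
def decOrd {m : ℕ} (S T : Finset (Fin m)) : Prop := ∃ T' ⊆ T, shLE S T'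

/-- A decreasing family of finsets. -/
def Decreasing {m : ℕ} (I : Finset (Finset (Fin m))) : Prop :=
  ∀ S T : Finset (Fin m), decOrd S T → T ∈ I → S ∈ I

/-- The code `C(I)`: the span of the monomials indexed by `I`. -/
noncomputable def code {m : ℕ} (I : Finset (Finset (Fin m))) :
    Submodule (ZMod 2) (BF m) :=
  Submodule.span (ZMod 2) (mono '' ↑I)

/-- `J_S(i) = {j < i : j ∉ S}`. -/
def Jset {m : ℕ} (S : Finset (Fin m)) (i : Fin m) : Finset (Fin m) :=
  Finset.univ.filter fun j => j < i ∧ j ∉ S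

/-- `J_{fg}(i) = {j < i : j ∉ S_f ∪ S_g}`. -/
def Jfg {m : ℕ} (Sf Sg : Finset (Fin m)) (i : Fin m) : Finset (Fin m) :=
  Jset (Sf ∪ Sg) i

/-- `|λ_S(T)| = ∑_{i ∈ T} |J_S(i)|`. -/
def lamOf {m : ℕ} (S T : Finset (Fin m)) : ℕ := ∑ i ∈ T, (Jset S i).card

/-- The column set `J_{fg}(i_l)`, where `i_l` is the largest element of
`S_{h*} = (S_f \ S_h) ∩ S_g` (empty if `S_{h*}` is empty). -/
def Jcols {m : ℕ} (Sf Sg Sh : Finset (Fin m)) : Finset (Fin m) :=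
  Finset.univ.filter fun j => (∃ i ∈ (Sf \ Sh) ∩ Sg, j < i) ∧ j ∉ Sf ∪ Sg

/-- The restricted subgroup `LTA(m,2)_f^g`: members of `LTA(m,2)_{S_f}` whose
submatrix with rows `S_{h*} = (S_f \ S_h) ∩ S_g` and columns `J_{fg}(i_l)` has
full row rank. -/
def LTAres {m : ℕ} (Sf Sg Sh : Finset (Fin m)) :
    Set ((Fin m → Fin m → ZMod 2) × (Fin m → ZMod 2)) :=
  { p ∈ LTAsub Sf |
      Matrix.rank
        (Matrix.of fun (i : ((Sf \ Sh) ∩ Sg : Finset (Fin m)))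
          (j : (Jcols Sf Sg Sh : Finset (Fin m))) => p.1 i.1 j.1)
        = ((Sf \ Sh) ∩ Sg).card }

/-- The orbit `LTA(m,2)_f^g·x^{S_f \ S_h}`. -/
def orbitRes {m : ℕ} (Sf Sg Sh : Finset (Fin m)) : Set (BF m) :=
  { F | ∃ p ∈ LTAres Sf Sg Sh, F = act p.1 p.2 (Sf \ Sh) }

/-- `J_f^I(i) = {j < i : j ∉ S_f, (S_f \ {i}) ∪ {j} ∈ I}`. -/
def JfI {m : ℕ} (I : Finset (Finset (Fin m))) (Sf : Finset (Fin m)) (i : Fin m) :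
    Finset (Fin m) :=
  Finset.univ.filter fun j => j < i ∧ j ∉ Sf ∧ insert j (Sf.erase i) ∈ I

/-- The orbit `LTA(m,2)_f^{f,I}·x^{S_f \ S_h}`. -/
def orbitFI {m : ℕ} (I : Finset (Finset (Fin m))) (Sf Sh : Finset (Fin m)) :
    Set (BF m) :=
  { F | ∃ B : Fin m → Fin m → ZMod 2, ∃ ε : Fin m → ZMod 2,
      (∀ i, i ∉ Sf \ Sh → ε i = 0) ∧
      (∀ i j, B i j ≠ 0 → i ∈ Sf \ Sh ∧ j ∈ JfI I Sf i) ∧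
      LinearIndependent (ZMod 2) (fun i : ((Sf \ Sh) : Finset (Fin m)) => B i.1) ∧
      F = act B ε (Sf \ Sh) }

/-- The pivots of a space `W` of coefficient vectors: the largest indices in the
supports of its nonzero elements. -/
def IsPivot {m : ℕ} (W : Submodule (ZMod 2) (Fin m → ZMod 2)) (i : Fin m) : Prop :=
  ∃ w ∈ W, w i = 1 ∧ ∀ j, i < j → w j = 0

open Classical in
/-- The finset of pivots of `W`. -/
noncomputable def pivots {m : ℕ} (W : Submodule (ZMod 2) (Fin m → ZMod 2)) :
    Finset (Fin m) := Finset.univ.filter (IsPivot W)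

/-- The coefficient vectors supported on the indices below `t`. -/
def lowSpace (m t : ℕ) : Submodule (ZMod 2) (Fin m → ZMod 2) where
  carrier := { w | ∀ j : Fin m, t ≤ (j : ℕ) → w j = 0 }
  add_mem' := by
    intro a b ha hb j hj
    simp [ha j hj, hb j hj]
  zero_mem' := by simp
  smul_mem' := by
    intro x a ha j hj
    simp [ha j hj]

/-- Restriction of the vectors in `W` to the coordinates in `S`. -/
def restr {m : ℕ} (W : Submodule (ZMod 2) (Fin m → ZMod 2)) (S : Finset (Fin m)) :
    W →ₗ[ZMod 2] (S → ZMod 2) where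
  toFun w j := w.1 j.1
  map_add' _ _ := rfl
  map_smul' _ _ := rfl

open Classical in
/-- The indicator function of the affine space `a + W^⊥`. -/
noncomputable def annInd {m : ℕ} (a : Fin m → ZMod 2)
    (W : Submodule (ZMod 2) (Fin m → ZMod 2)) : BF m :=
  fun v => if ∀ w ∈ W, w ⬝ᵥ v = w ⬝ᵥ a then 1 else 0

open Classical in
/-- The coefficient of `x^S` in the algebraic normal form of a Boolean function. -/
noncomputable def anfCoeff {m : ℕ} (S : Finset (Fin m)) : BF m →ₗ[ZMod 2] ZMod 2 where
  toFun F := ∑ v : Fin m → ZMod 2 with ∀ j, j ∉ S → v j = 0, F v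
  map_add' F G := by simp [Finset.sum_add_distrib]
  map_smul' x F := by simp [Finset.mul_sum]

lemma zmod_two_eq_one_of_ne_zero {x : ZMod 2} (h : x ≠ 0) : x = 1 := by
  revert x; decide

lemma zmod_two_ext {x y : ZMod 2} (h : x = 1 ↔ y = 1) : x = y := by
  revert x y; decide

section Pivots

variable {m : ℕ} {W : Submodule (ZMod 2) (Fin m → ZMod 2)}

lemma mem_pivots {i : Fin m} :
    i ∈ pivots W ↔ ∃ w ∈ W, w i = 1 ∧ ∀ j, i < j → w j = 0 := by
  simp [pivots, IsPivot]

lemma exists_pivot_of_ne_zero {w : Fin m → ZMod 2} (hw : w ∈ W) (h0 : w ≠ 0) :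
    ∃ i ∈ pivots W, w i = 1 ∧ ∀ j, i < j → w j = 0 := by
  classical
  have hne : (Finset.univ.filter fun j => w j ≠ 0).Nonempty := by
    obtain ⟨j, hj⟩ := Function.ne_iff.1 h0
    exact ⟨j, by simpa using hj⟩
  have hmem := Finset.max'_mem _ hne
  set i := Finset.max' _ hne with hi
  have h1 : w i = 1 := zmod_two_eq_one_of_ne_zero (by simpa using hmem)
  have h2 : ∀ j, i < j → w j = 0 := by
    intro j hj
    by_contra hc
    exact absurd (Finset.le_max' _ j (by simpa using hc)) (not_le.2 hj)
  exact ⟨i, mem_pivots.2 ⟨w, hw, h1, h2⟩, h1, h2⟩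

lemma restr_pivots_injective : Function.Injective (restr W (pivots W)) := by
  rw [← LinearMap.ker_eq_bot, LinearMap.ker_eq_bot']
  rintro ⟨w, hw⟩ h
  by_contra h0
  obtain ⟨i, hi, h1, -⟩ := exists_pivot_of_ne_zero hw (fun h => h0 (Subtype.ext h))
  have : w i = 0 := congrFun h ⟨i, hi⟩
  simp [this] at h1

lemma exists_eq_on_pivots (n : ℕ) (p : Fin m → ZMod 2)
    (hp : ∀ j : Fin m, n ≤ (j : ℕ) → p j = 0) :
    ∃ w ∈ W, ∀ j ∈ pivots W, w j = p j := by
  induction n generalizing p with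
  | zero => exact ⟨0, W.zero_mem, fun j _ => (hp j (Nat.zero_le _)).symm⟩
  | succ n ih =>
    by_cases hn : ∃ i ∈ pivots W, (i : ℕ) = n
    · obtain ⟨i, hi, rfl⟩ := hn
      obtain ⟨u, hu, hui, huj⟩ := mem_pivots.1 hi
      obtain ⟨w, hw, h⟩ := ih (p - p i • u) (by
        intro j hj
        rcases eq_or_lt_of_le hj with hij | hij
        · rw [← Fin.ext hij]
          simp [hui]
        · simp [hp j hij, huj j hij])
      refine ⟨w + p i • u, W.add_mem hw (W.smul_mem _ hu), fun j hj => ?_⟩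
      simp [h j hj]
    · obtain ⟨w, hw, h⟩ := ih (fun j => if (j : ℕ) = n then 0 else p j) (by
        intro j hj
        by_cases hjn : (j : ℕ) = n
        · simp [hjn]
        · simpa [hjn] using hp j (by omega))
      refine ⟨w, hw, fun j hj => ?_⟩
      rw [h j hj, if_neg fun hjn => hn ⟨j, hj, hjn⟩]

lemma restr_pivots_surjective : Function.Surjective (restr W (pivots W)) := by
  classical
  intro p
  obtain ⟨w, hw, h⟩ := exists_eq_on_pivots (W := W) m
    (fun j => if hj : j ∈ pivots W then p ⟨j, hj⟩ else 0) (fun j hj => by omega)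
  refine ⟨⟨w, hw⟩, funext fun j => ?_⟩
  change w j.1 = p j
  simpa [j.2] using h j.1 j.2

lemma finrank_eq_card_pivots : Module.finrank (ZMod 2) W = (pivots W).card := by
  simpa using (LinearEquiv.ofBijective (restr W (pivots W))
    ⟨restr_pivots_injective, restr_pivots_surjective⟩).finrank_eq

lemma pivots_mono {U : Submodule (ZMod 2) (Fin m → ZMod 2)} (h : U ≤ W) :
    pivots U ⊆ pivots W := by
  intro i hi
  obtain ⟨w, hw, hwi⟩ := mem_pivots.1 hi
  exact mem_pivots.2 ⟨w, h hw, hwi⟩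

lemma pivots_inf_lowSpace (t : ℕ) :
    pivots (W ⊓ lowSpace m t) = (pivots W).filter fun i : Fin m => (i : ℕ) < t := by
  ext i
  rw [Finset.mem_filter]
  constructor
  · intro hi
    refine ⟨pivots_mono inf_le_left hi, ?_⟩
    obtain ⟨w, hw, hwi, -⟩ := mem_pivots.1 hi
    by_contra hc
    have := hw.2 i (not_lt.1 hc)
    simp [this] at hwi
  · rintro ⟨hi, hit⟩
    obtain ⟨w, hw, hwi, h⟩ := mem_pivots.1 hi
    exact mem_pivots.2 ⟨w, ⟨hw, fun j hj => h j (Fin.lt_def.2 (hit.trans_le hj))⟩, hwi, h⟩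

lemma finrank_inf_lowSpace (t : ℕ) :
    Module.finrank (ZMod 2) (W ⊓ lowSpace m t : Submodule (ZMod 2) (Fin m → ZMod 2)) =
      ((pivots W).filter fun i : Fin m => (i : ℕ) < t).card := by
  rw [finrank_eq_card_pivots, pivots_inf_lowSpace]

/-- The reduced echelon basis of `W`. -/
lemma exists_reduced (W : Submodule (ZMod 2) (Fin m → ZMod 2)) :
    ∃ b : Fin m → Fin m → ZMod 2, ∀ i ∈ pivots W, b i ∈ W ∧ b i i = 1 ∧
      (∀ j, i < j → b i j = 0) ∧ ∀ j ∈ pivots W, j ≠ i → b i j = 0 := by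
  classical
  have key : ∀ i, ∃ w : Fin m → ZMod 2, i ∈ pivots W → w ∈ W ∧ w i = 1 ∧
      (∀ j, i < j → w j = 0) ∧ ∀ j ∈ pivots W, j ≠ i → w j = 0 := by
    intro i
    obtain ⟨w, hw, h⟩ := exists_eq_on_pivots (W := W) m (Pi.single i 1)
      (fun j hj => by omega)
    refine ⟨w, fun hi => ?_⟩
    have h1 : w i = 1 := by simpa using h i hi
    have h2 : ∀ j ∈ pivots W, j ≠ i → w j = 0 := fun j hj hji => by simp [h j hj, hji]
    obtain ⟨k, hk, hk1, hk2⟩ := exists_pivot_of_ne_zero hw (fun h0 => by simp [h0] at h1)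
    have hki : k = i := by
      by_contra hc
      simp [h2 k hk hc] at hk1
    exact ⟨hw, h1, hki ▸ hk2, h2⟩
  choose b hb using key
  exact ⟨b, hb⟩

lemma sup_span_reduced_eq {U : Submodule (ZMod 2) (Fin m → ZMod 2)} (hUW : U ≤ W)
    {b : Fin m → Fin m → ZMod 2} (hb : ∀ i ∈ pivots W, b i ∈ W ∧ b i i = 1 ∧
      (∀ j, i < j → b i j = 0) ∧ ∀ j ∈ pivots W, j ≠ i → b i j = 0) :
    U ⊔ Submodule.span (ZMod 2) (b '' ↑(pivots W \ pivots U)) = W := by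
  have hle : U ⊔ Submodule.span (ZMod 2) (b '' ↑(pivots W \ pivots U)) ≤ W := by
    refine sup_le hUW (Submodule.span_le.2 ?_)
    rintro _ ⟨i, hi, rfl⟩
    exact (hb i (Finset.mem_sdiff.1 hi).1).1
  refine Submodule.eq_of_le_of_finrank_le hle ?_
  rw [finrank_eq_card_pivots, finrank_eq_card_pivots]
  refine Finset.card_le_card fun i hi => ?_
  by_cases hiU : i ∈ pivots U
  · exact pivots_mono le_sup_left hiU
  · refine mem_pivots.2 ⟨b i, le_sup_right (a := U) (Submodule.subset_span ⟨i, ?_, rfl⟩),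
      (hb i hi).2.1, (hb i hi).2.2.1⟩
    simpa using ⟨hi, hiU⟩

lemma card_pivots_filter_le_of_injective {S : Finset (Fin m)}
    (h : Function.Injective (restr W S)) (t : ℕ) :
    ((pivots W).filter fun i : Fin m => (i : ℕ) < t).card ≤
      (S.filter fun i : Fin m => (i : ℕ) < t).card := by
  rw [← finrank_inf_lowSpace]
  have hinj : Function.Injective
      (restr (W ⊓ lowSpace m t) (S.filter fun i : Fin m => (i : ℕ) < t)) := by
    rw [← LinearMap.ker_eq_bot, LinearMap.ker_eq_bot']
    rintro ⟨w, hw, hwt⟩ h0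
    have : (⟨w, hw⟩ : W) = 0 := by
      apply h
      rw [map_zero]
      funext j
      by_cases hj : (j.1 : ℕ) < t
      · exact congrFun h0 ⟨j.1, Finset.mem_filter.2 ⟨j.2, hj⟩⟩
      · exact hwt j.1 (not_lt.1 hj)
    have hw0 : w = 0 := congrArg Subtype.val this
    exact Subtype.ext hw0
  have := LinearMap.finrank_le_finrank_of_injective hinj
  rwa [Module.finrank_fintype_fun_eq_card, Fintype.card_coe] at this

lemma restr_swap_injective_iff {b : Fin m → Fin m → ZMod 2}
    (hb : ∀ i ∈ pivots W, b i ∈ W ∧ b i i = 1 ∧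
      (∀ j, i < j → b i j = 0) ∧ ∀ j ∈ pivots W, j ≠ i → b i j = 0)
    {i j : Fin m} (hi : i ∈ pivots W) :
    Function.Injective (restr W (insert j ((pivots W).erase i))) ↔ b i j = 1 := by
  obtain ⟨hbW, hbi, -, hb0⟩ := hb i hi
  constructor
  · intro h
    by_contra hc
    have hj0 : b i j = 0 := by
      by_contra h0
      exact hc (zmod_two_eq_one_of_ne_zero h0)
    have : (⟨b i, hbW⟩ : W) = 0 := by
      apply h
      rw [map_zero]
      funext k
      rcases Finset.mem_insert.1 k.2 with hk | hk
      · change b i k.1 = 0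
        rw [hk, hj0]
      · exact hb0 k.1 (Finset.mem_of_mem_erase hk) (Finset.ne_of_mem_erase hk)
    have h0 : b i = 0 := congrArg Subtype.val this
    simp [h0] at hbi
  · intro hj
    rw [← LinearMap.ker_eq_bot, LinearMap.ker_eq_bot']
    rintro ⟨w, hw⟩ h0
    have hv : ∀ k ∈ insert j ((pivots W).erase i), w k = 0 := fun k hk => congrFun h0 ⟨k, hk⟩
    have heq : (⟨w, hw⟩ : W) = w i • ⟨b i, hbW⟩ := by
      apply restr_pivots_injective
      funext k
      change w k.1 = w i * b i k.1
      by_cases hki : k.1 = i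
      · simp [hki, hbi]
      · rw [hb0 k.1 k.2 hki, hv k.1 (Finset.mem_insert_of_mem (Finset.mem_erase.2 ⟨hki, k.2⟩)),
          mul_zero]
    have hwj : w j = w i * b i j := congrFun (congrArg Subtype.val heq) j
    rw [hv j (Finset.mem_insert_self _ _), hj, mul_one] at hwj
    rw [heq, ← hwj, zero_smul]

end Pivots

section Coefficients

variable {m : ℕ}

lemma anfCoeff_apply (S : Finset (Fin m)) (F : BF m) [DecidablePred fun v : Fin m → ZMod 2 =>
    ∀ j, j ∉ S → v j = 0] :
    anfCoeff S F = ∑ v : Fin m → ZMod 2 with ∀ j, j ∉ S → v j = 0, F v := by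
  unfold anfCoeff
  simp only [LinearMap.coe_mk, AddHom.coe_mk]
  congr!

lemma anfCoeff_eq_zero_of_translate {S : Finset (Fin m)} {F : BF m} {u : Fin m → ZMod 2}
    (hu : u ≠ 0) (huS : ∀ j, j ∉ S → u j = 0) (hF : ∀ v, F (v + u) = F v) :
    anfCoeff S F = 0 := by
  classical
  rw [anfCoeff_apply]
  have huu : u + u = 0 := funext fun j => CharTwo.add_self_eq_zero (u j)
  refine Finset.sum_involution (fun v _ => v + u) ?_ ?_ ?_ ?_
  · intro v _
    rw [hF, CharTwo.add_self_eq_zero]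
  · intro v _ _ h
    exact hu (by simpa using h)
  · intro v hv
    simp only [Finset.mem_filter, Finset.mem_univ, true_and] at hv ⊢
    intro j hj
    simp [hv j hj, huS j hj]
  · intro v _
    rw [add_assoc, huu, add_zero]

lemma anfCoeff_mono_of_ne {S T : Finset (Fin m)} (h : S ≠ T) : anfCoeff S (mono T) = 0 := by
  classical
  by_cases hTS : T ⊆ S
  · obtain ⟨i, hi, hiT⟩ := Finset.exists_of_ssubset (hTS.ssubset_of_ne h.symm)
    refine anfCoeff_eq_zero_of_translate (u := Pi.single i 1) ?_ ?_ ?_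
    · intro h0
      simpa using congrFun h0 i
    · intro j hj
      exact Pi.single_eq_of_ne (fun hji : j = i => hj (hji ▸ hi)) _
    · intro v
      refine Finset.prod_congr rfl fun j hj => ?_
      rw [Pi.add_apply, Pi.single_eq_of_ne (fun hji : j = i => hiT (hji ▸ hj)), add_zero]
  · obtain ⟨i, hiT, hiS⟩ := Finset.not_subset.1 hTS
    rw [anfCoeff_apply]
    refine Finset.sum_eq_zero fun v hv => ?_
    exact Finset.prod_eq_zero hiT ((Finset.mem_filter.1 hv).2 i hiS)

lemma anfCoeff_eq_zero_of_mem_code {I : Finset (Finset (Fin m))} {P : BF m}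
    (hP : P ∈ code I) {S : Finset (Fin m)} (hS : S ∉ I) : anfCoeff S P = 0 := by
  have hle : code I ≤ LinearMap.ker (anfCoeff S) := by
    refine Submodule.span_le.2 ?_
    rintro _ ⟨T, hT, rfl⟩
    exact anfCoeff_mono_of_ne fun h => hS (h ▸ hT)
  exact hle hP

variable {W : Submodule (ZMod 2) (Fin m → ZMod 2)}

lemma annInd_eq_one_iff {a v : Fin m → ZMod 2} :
    annInd a W v = 1 ↔ ∀ w ∈ W, w ⬝ᵥ v = w ⬝ᵥ a := by
  unfold annInd
  split_ifs with h
  · exact iff_of_true rfl h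
  · exact iff_of_false zero_ne_one h

lemma annInd_eq_ite {a v : Fin m → ZMod 2} [Decidable (∀ w ∈ W, w ⬝ᵥ v = w ⬝ᵥ a)] :
    annInd a W v = if ∀ w ∈ W, w ⬝ᵥ v = w ⬝ᵥ a then 1 else 0 := by
  unfold annInd
  congr

lemma dotProduct_extend {S : Finset (Fin m)} (w v : Fin m → ZMod 2)
    (hv : ∀ j, j ∉ S → v j = 0) : w ⬝ᵥ v = ∑ j : S, w j.1 * v j.1 := by
  rw [Finset.sum_coe_sort S (fun j => w j * v j), dotProduct]
  refine (Finset.sum_subset (Finset.subset_univ S) fun j _ hj => ?_).symm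
  rw [hv j hj, mul_zero]

lemma anfCoeff_annInd_of_bijective (a : Fin m → ZMod 2) {S : Finset (Fin m)}
    (h : Function.Bijective (restr W S)) : anfCoeff S (annInd a W) = 1 := by
  classical
  let e := LinearEquiv.ofBijective (restr W S) h
  let φ : (S → ZMod 2) →ₗ[ZMod 2] ZMod 2 :=
    (dotProductEquiv (ZMod 2) (Fin m) a ∘ₗ W.subtype) ∘ₗ e.symm.toLinearMap
  let v₀ : Fin m → ZMod 2 := fun j => if hj : j ∈ S then φ (Pi.single ⟨j, hj⟩ 1) else 0
  have hφ (w : W) : φ (restr W S w) = w.1 ⬝ᵥ a := by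
    have : e.symm (restr W S w) = w := e.symm_apply_apply w
    simp [φ, this, dotProduct_comm]
  have hv₀ : ∀ j, j ∉ S → v₀ j = 0 := fun j hj => dif_neg hj
  have key (v : Fin m → ZMod 2) (hv : ∀ j, j ∉ S → v j = 0) :
      (∀ w ∈ W, w ⬝ᵥ v = w ⬝ᵥ a) ↔ v = v₀ := by
    constructor
    · intro hw
      funext j
      by_cases hj : j ∈ S
      · obtain ⟨w, hwj⟩ := h.2 (Pi.single ⟨j, hj⟩ 1)
        have h1 := hw w.1 w.2
        rw [← hφ, hwj, dotProduct_extend _ _ hv] at h1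
        have h2 : ∀ k : S, w.1 k.1 = (Pi.single ⟨j, hj⟩ 1 : S → ZMod 2) k := congrFun hwj
        simp only [h2, Pi.single_apply, ite_mul, one_mul, zero_mul, Finset.sum_ite_eq',
          Finset.mem_univ, if_true] at h1
        rw [h1]
        simp [v₀, hj]
      · rw [hv j hj, hv₀ j hj]
    · rintro rfl w hw
      rw [← hφ ⟨w, hw⟩, dotProduct_extend _ _ hv₀, LinearMap.pi_apply_eq_sum_univ φ]
      refine Finset.sum_congr rfl fun j _ => ?_
      have : v₀ j.1 = φ (Pi.single j 1) := dif_pos j.2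
      rw [this, smul_eq_mul]
      congr 2
      funext k
      simp [Pi.single_apply, eq_comm]
  rw [anfCoeff_apply, Finset.sum_eq_single v₀]
  · exact annInd_eq_one_iff.2 ((key v₀ hv₀).2 rfl)
  · intro v hv hne
    rw [annInd_eq_ite, if_neg]
    rwa [key v (Finset.mem_filter.1 hv).2]
  · intro hn
    exact absurd (Finset.mem_filter.2 ⟨Finset.mem_univ _, hv₀⟩) hn

lemma anfCoeff_annInd_of_not_surjective (a : Fin m → ZMod 2) {S : Finset (Fin m)}
    (h : ¬ Function.Surjective (restr W S)) : anfCoeff S (annInd a W) = 0 := by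
  classical
  obtain ⟨φ, hφ0, hφ⟩ := Submodule.exists_le_ker_of_lt_top (LinearMap.range (restr W S))
    (lt_top_iff_ne_top.2 fun ht => h (LinearMap.range_eq_top.1 ht))
  let u : Fin m → ZMod 2 := fun j => if hj : j ∈ S then φ (Pi.single ⟨j, hj⟩ 1) else 0
  have huS : ∀ j, j ∉ S → u j = 0 := fun j hj => dif_neg hj
  have hu (j : S) : u j.1 = φ (Pi.single j 1) := dif_pos j.2
  refine anfCoeff_eq_zero_of_translate (u := u) ?_ huS ?_
  · intro h0
    apply hφ0
    refine LinearMap.pi_ext' fun j => LinearMap.ext_ring ?_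
    simpa [h0] using (hu j).symm
  · intro v
    have horth : ∀ w ∈ W, w ⬝ᵥ u = 0 := by
      intro w hw
      have h1 : φ (restr W S ⟨w, hw⟩) = 0 := hφ ⟨_, rfl⟩
      rw [LinearMap.pi_apply_eq_sum_univ φ] at h1
      rw [dotProduct_extend _ _ huS, ← h1]
      refine Finset.sum_congr rfl fun j _ => ?_
      rw [hu, smul_eq_mul]
      congr 2
      funext k
      simp [Pi.single_apply, eq_comm]
    apply zmod_two_ext
    rw [annInd_eq_one_iff, annInd_eq_one_iff]
    refine forall₂_congr fun w hw => ?_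
    rw [dotProduct_add, horth w hw, add_zero]

lemma anfCoeff_annInd_eq_one_iff (a : Fin m → ZMod 2) {S : Finset (Fin m)}
    (hS : S.card = Module.finrank (ZMod 2) W) :
    anfCoeff S (annInd a W) = 1 ↔ Function.Injective (restr W S) := by
  have hiff : Function.Injective (restr W S) ↔ Function.Surjective (restr W S) :=
    LinearMap.injective_iff_surjective_of_finrank_eq_finrank (by simp [hS])
  constructor
  · intro h1
    rw [hiff]
    by_contra hs
    rw [anfCoeff_annInd_of_not_surjective a hs] at h1
    exact zero_ne_one h1
  · exact fun h => anfCoeff_annInd_of_bijective a ⟨h, hiff.1 h⟩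

end Coefficients

section Orders

variable {m : ℕ} {S T : Finset (Fin m)}

lemma shLE_of_card_filter_le (hc : S.card = T.card)
    (h : ∀ t : ℕ, (T.filter fun i : Fin m => (i : ℕ) < t).card ≤
      (S.filter fun i : Fin m => (i : ℕ) < t).card) : shLE S T := by
  classical
  refine ⟨hc, fun l => ?_⟩
  by_contra hlt
  rw [not_le] at hlt
  set t : ℕ := (S.orderEmbOfFin rfl l).val
  have h1 : ((Finset.Iic l).map (T.orderEmbOfFin hc.symm).toEmbedding).card ≤
      (T.filter fun i : Fin m => (i : ℕ) < t).card := by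
    refine Finset.card_le_card fun x hx => ?_
    obtain ⟨k, hk, rfl⟩ := Finset.mem_map.1 hx
    refine Finset.mem_filter.2 ⟨Finset.orderEmbOfFin_mem _ _ _, ?_⟩
    exact lt_of_le_of_lt ((T.orderEmbOfFin hc.symm).monotone (Finset.mem_Iic.1 hk)) hlt
  have h2 : (S.filter fun i : Fin m => (i : ℕ) < t).card ≤
      ((Finset.Iio l).map (S.orderEmbOfFin rfl).toEmbedding).card := by
    refine Finset.card_le_card fun x hx => ?_
    obtain ⟨hxS, hxt⟩ := Finset.mem_filter.1 hx
    obtain ⟨k, rfl⟩ : x ∈ Set.range (S.orderEmbOfFin rfl) := by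
      rw [Finset.range_orderEmbOfFin]
      exact hxS
    exact Finset.mem_map.2 ⟨k, Finset.mem_Iio.2
      ((S.orderEmbOfFin rfl).lt_iff_lt.1 (Fin.lt_def.2 hxt)), rfl⟩
  have := h1.trans ((h t).trans h2)
  simp at this

lemma shLE.shLT_of_disjoint (h : shLE S T) (hd : Disjoint S T) : shLT S T := by
  obtain ⟨hc, h⟩ := h
  refine ⟨hc, fun l => lt_of_le_of_ne (h l) fun he => ?_⟩
  exact Finset.disjoint_left.1 hd (Finset.orderEmbOfFin_mem S rfl l)
    (he ▸ Finset.orderEmbOfFin_mem T hc.symm l)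

lemma shLE_refl (S : Finset (Fin m)) : shLE S S := ⟨rfl, fun _ => le_rfl⟩

lemma decOrd_of_subset (h : S ⊆ T) : decOrd S T := ⟨S, h, shLE_refl S⟩

lemma shLE.decOrd (h : shLE S T) : decOrd S T := ⟨T, subset_rfl, h⟩

lemma eq_of_card_filter_eq (h : ∀ t : ℕ, (T.filter fun i : Fin m => (i : ℕ) < t).card =
      (S.filter fun i : Fin m => (i : ℕ) < t).card) : S = T := by
  have hstep (U : Finset (Fin m)) (i : Fin m) :
      (U.filter fun j : Fin m => (j : ℕ) < i + 1).card =
        (U.filter fun j : Fin m => (j : ℕ) < i).card + if i ∈ U then 1 else 0 := by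
    have : (U.filter fun j : Fin m => (j : ℕ) < i + 1) =
        (U.filter fun j : Fin m => (j : ℕ) < i) ∪ U.filter fun j => j = i := by
      ext j
      simp only [Finset.mem_filter, Finset.mem_union, Fin.ext_iff]
      grind
    rw [this, Finset.card_union_of_disjoint, Finset.filter_eq']
    · split_ifs <;> simp
    · rw [Finset.disjoint_filter]
      rintro j - hj rfl
      exact lt_irrefl _ hj
  ext i
  have h1 := h (i + 1)
  rw [hstep, hstep, h i] at h1
  by_cases hS : i ∈ S <;> by_cases hT : i ∈ T <;> simp_all

end Orders

section Indicators

variable {m : ℕ} {a : Fin m → ZMod 2} {W : Submodule (ZMod 2) (Fin m → ZMod 2)}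

lemma zmod_two_prod_eq_one_iff {ι : Type*} {K : Finset ι} {f : ι → ZMod 2} :
    ∏ k ∈ K, f k = 1 ↔ ∀ k ∈ K, f k = 1 := by
  refine ⟨fun h k hk => zmod_two_eq_one_of_ne_zero ?_, Finset.prod_eq_one⟩
  exact Finset.prod_ne_zero_iff.1 (h ▸ one_ne_zero) k hk

lemma prod_affine_eq_annInd {ι : Type*} {c : ι → Fin m → ZMod 2} {d : ι → ZMod 2}
    (K : Finset ι) (h : ∀ k ∈ K, c k ⬝ᵥ a = d k + 1) :
    (∏ k ∈ K, ((fun v => (∑ j, c k j * v j) + d k) : BF m)) =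
      annInd a (Submodule.span (ZMod 2) (c '' ↑K)) := by
  funext v
  apply zmod_two_ext
  rw [annInd_eq_one_iff, Finset.prod_apply, zmod_two_prod_eq_one_iff]
  have hk : ∀ k ∈ K, ((∑ j, c k j * v j) + d k = 1 ↔ c k ⬝ᵥ v = c k ⬝ᵥ a) := by
    intro k hk
    rw [h k hk, dotProduct]
    generalize (∑ j, c k j * v j) = x
    generalize d k = y
    revert x y
    decide
  constructor
  · intro hv w hw
    induction hw using Submodule.span_induction with
    | mem w hw =>
      obtain ⟨k, hkK, rfl⟩ := hw
      exact (hk k hkK).1 (hv k hkK)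
    | zero => simp
    | add x y _ _ hx hy => rw [add_dotProduct, add_dotProduct, hx, hy]
    | smul r x _ hx => rw [smul_dotProduct, smul_dotProduct, hx]
  · intro hv k hkK
    exact (hk k hkK).2 (hv _ (Submodule.subset_span ⟨k, hkK, rfl⟩))

lemma annInd_mul (U : Submodule (ZMod 2) (Fin m → ZMod 2)) :
    annInd a W * annInd a U = annInd a (W ⊔ U) := by
  have hone : ∀ x y : ZMod 2, x * y = 1 ↔ x = 1 ∧ y = 1 := by decide
  funext v
  apply zmod_two_ext
  rw [Pi.mul_apply, hone, annInd_eq_one_iff, annInd_eq_one_iff, annInd_eq_one_iff]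
  constructor
  · rintro ⟨h1, h2⟩ w hw
    obtain ⟨x, hx, y, hy, rfl⟩ := Submodule.mem_sup.1 hw
    rw [add_dotProduct, add_dotProduct, h1 x hx, h2 y hy]
  · exact fun h => ⟨fun w hw => h w (Submodule.mem_sup_left hw),
      fun w hw => h w (Submodule.mem_sup_right hw)⟩

/-- Every space of coefficient vectors gives a reduced affine pair describing the
indicator of `a + W^⊥` relative to any subspace. -/
lemma exists_affine_pair (a : Fin m → ZMod 2) {b : Fin m → Fin m → ZMod 2}
    (hb : ∀ i ∈ pivots W, b i ∈ W ∧ b i i = 1 ∧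
      (∀ j, i < j → b i j = 0) ∧ ∀ j ∈ pivots W, j ≠ i → b i j = 0) :
    ∃ p ∈ LTAsub (pivots W), (∀ i ∈ pivots W, ∀ j, j ≠ i → p.1 i j = b i j) ∧
      ∀ U ≤ W, annInd a W = annInd a U * act p.1 p.2 (pivots W \ pivots U) := by
  classical
  refine ⟨(fun i j => if i ∈ pivots W ∧ j ≠ i then b i j else 0,
    fun i => if i ∈ pivots W then b i ⬝ᵥ a + 1 else 0), ⟨?_, ?_⟩, ?_, ?_⟩
  · intro i hi
    simp [hi]
  · intro i j hij
    simp only [ne_eq, ite_eq_right_iff, Classical.not_imp] at hij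
    obtain ⟨⟨hi, hji⟩, hne⟩ := hij
    refine ⟨hi, lt_of_le_of_ne (not_lt.1 fun hlt => hne ((hb i hi).2.2.1 j hlt)) hji,
      fun hj => hne ((hb i hi).2.2.2 j hj hji)⟩
  · intro i hi j hji
    simp [hi, hji]
  · intro U hU
    have hact : act (fun i j => if i ∈ pivots W ∧ j ≠ i then b i j else 0)
        (fun i => if i ∈ pivots W then b i ⬝ᵥ a + 1 else 0) (pivots W \ pivots U) =
        ∏ i ∈ pivots W \ pivots U, ((fun v => (∑ j, b i j * v j) + (b i ⬝ᵥ a + 1)) : BF m) := by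
      funext v
      rw [Finset.prod_apply]
      refine Finset.prod_congr rfl fun i hi => ?_
      have hiW := (Finset.mem_sdiff.1 hi).1
      have hsum : v i + ∑ j, (if i ∈ pivots W ∧ j ≠ i then b i j else 0) * v j =
          ∑ j, b i j * v j := by
        rw [← Finset.add_sum_erase _ (fun j => b i j * v j) (Finset.mem_univ i),
          (hb i hiW).2.1, one_mul]
        congr 1
        rw [← Finset.add_sum_erase _ _ (Finset.mem_univ i)]
        simp only [ne_eq, not_true_eq_false, and_false, if_false, zero_mul, zero_add]
        refine Finset.sum_congr rfl fun j hj => ?_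
        rw [if_pos ⟨hiW, Finset.ne_of_mem_erase hj⟩]
      simp only [hsum, if_pos hiW]
    rw [hact, prod_affine_eq_annInd (a := a), annInd_mul, sup_span_reduced_eq hU hb]
    intro k _
    rw [add_assoc, CharTwo.add_self_eq_zero, add_zero]

end Indicators

section Classification

variable {m : ℕ} {Wf Wg : Submodule (ZMod 2) (Fin m → ZMod 2)}

/-- The pivots of `Wf ⊔ Wg` outside those of `Wf` and `Wg` lie strictly below the common
pivots of `Wf` and `Wg` that are not pivots of `Wf ⊓ Wg`. -/
lemma exists_shLT_common_pivots (Wf Wg : Submodule (ZMod 2) (Fin m → ZMod 2)) :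
    ∃ S : Finset (Fin m), Disjoint S (pivots Wf ∪ pivots Wg) ∧
      shLT S ((pivots Wf ∩ pivots Wg) \ pivots (Wf ⊓ Wg)) := by
  classical
  have hsub : pivots Wf ∪ pivots Wg ⊆ pivots (Wf ⊔ Wg) :=
    Finset.union_subset (pivots_mono le_sup_left) (pivots_mono le_sup_right)
  have hinf : pivots (Wf ⊓ Wg) ⊆ pivots Wf ∩ pivots Wg :=
    Finset.subset_inter (pivots_mono inf_le_left) (pivots_mono inf_le_right)
  have hle : ∀ t : ℕ,
      (((pivots Wf ∩ pivots Wg) \ pivots (Wf ⊓ Wg)).filter fun i : Fin m => (i : ℕ) < t).card ≤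
      ((pivots (Wf ⊔ Wg) \ (pivots Wf ∪ pivots Wg)).filter
        fun i : Fin m => (i : ℕ) < t).card := by
    intro t
    have h1 := Submodule.finrank_sup_add_finrank_inf_eq (Wf ⊓ lowSpace m t) (Wg ⊓ lowSpace m t)
    have h2 : Wf ⊓ lowSpace m t ⊓ (Wg ⊓ lowSpace m t) = Wf ⊓ Wg ⊓ lowSpace m t :=
      (inf_inf_distrib_right _ _ _).symm
    have h3 : Wf ⊓ lowSpace m t ⊔ Wg ⊓ lowSpace m t ≤ (Wf ⊔ Wg) ⊓ lowSpace m t :=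
      sup_le (inf_le_inf_right _ le_sup_left) (inf_le_inf_right _ le_sup_right)
    have h4 := Submodule.finrank_mono h3
    rw [h2] at h1
    simp only [finrank_inf_lowSpace] at h1 h4
    have h5 := Finset.card_union_add_card_inter
      ((pivots Wf).filter fun i : Fin m => (i : ℕ) < t)
      ((pivots Wg).filter fun i : Fin m => (i : ℕ) < t)
    rw [← Finset.filter_union, ← Finset.filter_inter_distrib] at h5
    have h6 (A B : Finset (Fin m)) : (A \ B).filter (fun i : Fin m => (i : ℕ) < t) =
        A.filter (fun i : Fin m => (i : ℕ) < t) \ B.filter fun i : Fin m => (i : ℕ) < t := by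
      ext i
      simp only [Finset.mem_filter, Finset.mem_sdiff]
      tauto
    rw [h6, h6,
      Finset.card_sdiff_of_subset (Finset.filter_subset_filter _ hsub),
      Finset.card_sdiff_of_subset (Finset.filter_subset_filter _ hinf)]
    omega
  have hcard : (pivots (Wf ⊔ Wg) \ (pivots Wf ∪ pivots Wg)).card =
      ((pivots Wf ∩ pivots Wg) \ pivots (Wf ⊓ Wg)).card := by
    have h1 := Submodule.finrank_sup_add_finrank_inf_eq Wf Wg
    simp only [finrank_eq_card_pivots] at h1
    have h5 := Finset.card_union_add_card_inter (pivots Wf) (pivots Wg)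
    have h6 := Finset.card_le_card hinf
    rw [Finset.card_sdiff_of_subset hsub, Finset.card_sdiff_of_subset hinf]
    omega
  refine ⟨_, Finset.sdiff_disjoint, (shLE_of_card_filter_le hcard hle).shLT_of_disjoint ?_⟩
  exact Finset.disjoint_of_subset_right
    (Finset.sdiff_subset.trans (Finset.inter_subset_left.trans Finset.subset_union_left))
    Finset.sdiff_disjoint

variable {a : Fin m → ZMod 2} {I : Finset (Finset (Fin m))}

lemma restr_injective_iff_of_mem_code (hP : annInd a Wf + annInd a Wg ∈ code I)
    (hfg : Module.finrank (ZMod 2) Wf = Module.finrank (ZMod 2) Wg) {S : Finset (Fin m)}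
    (hS : S.card = Module.finrank (ZMod 2) Wf) (hSI : S ∉ I) :
    Function.Injective (restr Wf S) ↔ Function.Injective (restr Wg S) := by
  have h := anfCoeff_eq_zero_of_mem_code hP hSI
  rw [map_add] at h
  rw [← anfCoeff_annInd_eq_one_iff a hS, ← anfCoeff_annInd_eq_one_iff a (hS.trans hfg)]
  revert h
  generalize anfCoeff S (annInd a Wf) = x
  generalize anfCoeff S (annInd a Wg) = y
  revert x y
  decide

lemma shLE_pivots_of_injective {W : Submodule (ZMod 2) (Fin m → ZMod 2)} {S : Finset (Fin m)}
    (hS : S.card = Module.finrank (ZMod 2) W) (h : Function.Injective (restr W S)) :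
    shLE S (pivots W) :=
  shLE_of_card_filter_le (hS.trans finrank_eq_card_pivots)
    (card_pivots_filter_le_of_injective h)

lemma pivots_mem_of_mem (hI : Decreasing I) (hP : annInd a Wf + annInd a Wg ∈ code I)
    (hfg : Module.finrank (ZMod 2) Wf = Module.finrank (ZMod 2) Wg) (hg : pivots Wg ∈ I) :
    pivots Wf ∈ I := by
  by_contra hf
  have h := (restr_injective_iff_of_mem_code hP hfg finrank_eq_card_pivots.symm hf).1
    restr_pivots_injective
  exact hf (hI _ _ (shLE_pivots_of_injective (finrank_eq_card_pivots.symm.trans hfg) h).decOrd hg)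

lemma pivots_eq_of_notMem (hP : annInd a Wf + annInd a Wg ∈ code I)
    (hfg : Module.finrank (ZMod 2) Wf = Module.finrank (ZMod 2) Wg)
    (hf : pivots Wf ∉ I) (hg : pivots Wg ∉ I) : pivots Wf = pivots Wg := by
  have h1 := (restr_injective_iff_of_mem_code hP hfg finrank_eq_card_pivots.symm hf).1
    restr_pivots_injective
  have h2 := (restr_injective_iff_of_mem_code hP hfg
    (finrank_eq_card_pivots.symm.trans hfg.symm) hg).2 restr_pivots_injective
  exact eq_of_card_filter_eq fun t => le_antisymm
    (card_pivots_filter_le_of_injective h1 t) (card_pivots_filter_le_of_injective h2 t)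

/-- Classification of the codewords that are sums of two indicators of affine spaces of the
same dimension. -/
lemma classification {r μ : ℕ} (hI : Decreasing I)
    (hP : annInd a Wf + annInd a Wg ∈ code I)
    (hf : Module.finrank (ZMod 2) Wf = r) (hg : Module.finrank (ZMod 2) Wg = r)
    (hh : Module.finrank (ZMod 2) (Wf ⊓ Wg : Submodule (ZMod 2) (Fin m → ZMod 2)) = r - μ)
    (hne : Wf ≠ Wg) :
    (∃ Sf ∈ I, ∃ Sg ∈ I, ∃ Sh ∈ I, Sf.card = r ∧ Sg.card = r ∧
      Sh.card = r - μ ∧ Sh ⊆ Sf ∩ Sg ∧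
      annInd a Wf + annInd a Wg ∈
        orbitSub Sh Sh * (orbitSub Sf (Sf \ Sh) + orbitSub Sg (Sg \ Sh)) ∧
      (Sh = Sf ∩ Sg ∨ (((Sf ∩ Sg) \ Sh).Nonempty ∧
          ∃ Sstar : Finset (Fin m), Disjoint Sstar (Sf ∪ Sg) ∧
            shLT Sstar ((Sf ∩ Sg) \ Sh)))) ∨
    (∃ Sf : Finset (Fin m), Sf ∉ I ∧ Sf.card = r ∧
      ∃ Sh ∈ I, Sh.card = r - μ ∧ Sh ⊆ Sf ∧
      ∃ H ∈ orbitSub Sh Sh, ∃ p ∈ LTAsub Sf, ∃ p' ∈ LTAsub Sf,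
        annInd a Wf + annInd a Wg = H * (act p.1 p.2 (Sf \ Sh) + act p'.1 p'.2 (Sf \ Sh)) ∧
        (∀ i ∈ Sf, ∀ j, j < i → j ∉ Sf → insert j (Sf.erase i) ∉ I →
          p.1 i j = p'.1 i j) ∧
        ∃ Sstar : Finset (Fin m), Disjoint Sstar Sf ∧ shLT Sstar (Sf \ Sh)) := by
  classical
  have hfg := hf.trans hg.symm
  have hinf : pivots (Wf ⊓ Wg) ⊆ pivots Wf ∩ pivots Wg :=
    Finset.subset_inter (pivots_mono inf_le_left) (pivots_mono inf_le_right)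
  obtain ⟨bh, hbh⟩ := exists_reduced (Wf ⊓ Wg)
  obtain ⟨bf, hbf⟩ := exists_reduced Wf
  obtain ⟨bg, hbg⟩ := exists_reduced Wg
  obtain ⟨q, hq, -, hqU⟩ := exists_affine_pair a hbh
  obtain ⟨p, hp, hpb, hpU⟩ := exists_affine_pair a hbf
  obtain ⟨p', hp', hpb', hpU'⟩ := exists_affine_pair a hbg
  have hH : annInd a (Wf ⊓ Wg) ∈ orbitSub (pivots (Wf ⊓ Wg)) (pivots (Wf ⊓ Wg)) := by
    refine ⟨q, hq, ?_⟩
    have hbot : pivots (⊥ : Submodule (ZMod 2) (Fin m → ZMod 2)) = ∅ := by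
      rw [← Finset.card_eq_zero, ← finrank_eq_card_pivots, finrank_bot]
    have hone : annInd a (⊥ : Submodule (ZMod 2) (Fin m → ZMod 2)) = 1 := by
      funext v
      exact annInd_eq_one_iff.2 (by simp)
    rw [hqU ⊥ bot_le, hbot, hone, one_mul, Finset.sdiff_empty]
  have hPeq : annInd a Wf + annInd a Wg = annInd a (Wf ⊓ Wg) *
      (act p.1 p.2 (pivots Wf \ pivots (Wf ⊓ Wg)) +
        act p'.1 p'.2 (pivots Wg \ pivots (Wf ⊓ Wg))) := by
    rw [mul_add, ← hpU _ inf_le_left, ← hpU' _ inf_le_right]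
  obtain ⟨Sstar, hdisj, hlt⟩ := exists_shLT_common_pivots Wf Wg
  by_cases hfI : pivots Wf ∈ I
  · have hgI : pivots Wg ∈ I :=
      pivots_mem_of_mem (a := a) hI (by rwa [add_comm]) hfg.symm hfI
    refine Or.inl ⟨pivots Wf, hfI, pivots Wg, hgI, pivots (Wf ⊓ Wg),
      hI _ _ (decOrd_of_subset (pivots_mono inf_le_left)) hfI, ?_, ?_, ?_, hinf, ?_, ?_⟩
    · rw [← finrank_eq_card_pivots, hf]
    · rw [← finrank_eq_card_pivots, hg]
    · rw [← finrank_eq_card_pivots, hh]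
    · rw [hPeq]
      exact Set.mul_mem_mul hH (Set.add_mem_add ⟨p, hp, rfl⟩ ⟨p', hp', rfl⟩)
    · rcases Finset.eq_empty_or_nonempty ((pivots Wf ∩ pivots Wg) \ pivots (Wf ⊓ Wg))
        with he | hn
      · exact Or.inl (hinf.antisymm (Finset.sdiff_eq_empty_iff_subset.1 he))
      · exact Or.inr ⟨hn, Sstar, hdisj, hlt⟩
  · have hgI : pivots Wg ∉ I := fun h => hfI (pivots_mem_of_mem hI hP hfg h)
    have heq : pivots Wf = pivots Wg := pivots_eq_of_notMem hP hfg hfI hgI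
    have hswap : ∀ i ∈ pivots Wf, ∀ j, j ∉ pivots Wf →
        insert j ((pivots Wf).erase i) ∉ I → bf i j = bg i j := by
      intro i hi j hj hS
      apply zmod_two_ext
      rw [← restr_swap_injective_iff hbf hi, ← restr_swap_injective_iff hbg (heq ▸ hi), ← heq]
      refine restr_injective_iff_of_mem_code hP hfg ?_ hS
      rw [Finset.card_insert_of_notMem (fun h => hj (Finset.mem_of_mem_erase h)),
        Finset.card_erase_add_one hi, finrank_eq_card_pivots]
    have hhI : pivots (Wf ⊓ Wg) ∈ I := by
      by_contra hhI
      apply hne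
      have hspf := sup_span_reduced_eq (inf_le_left : Wf ⊓ Wg ≤ Wf) hbf
      have hspg := sup_span_reduced_eq (inf_le_right : Wf ⊓ Wg ≤ Wg) hbg
      rw [← heq] at hspg
      refine hspf.symm.trans (Eq.trans ?_ hspg)
      congr 2
      refine Set.image_congr fun i hi => ?_
      obtain ⟨hiW, hih⟩ := Finset.mem_sdiff.1 hi
      funext j
      by_cases hj : j ∈ pivots Wf
      · by_cases hji : j = i
        · rw [hji, (hbf i hiW).2.1, (hbg i (heq ▸ hiW)).2.1]
        · rw [(hbf i hiW).2.2.2 j hj hji, (hbg i (heq ▸ hiW)).2.2.2 j (heq ▸ hj) hji]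
      · refine hswap i hiW j hj fun hS => hhI (hI _ _ (decOrd_of_subset fun k hk => ?_) hS)
        exact Finset.mem_insert_of_mem (Finset.mem_erase.2
          ⟨fun hki => hih (hki ▸ hk), pivots_mono inf_le_left hk⟩)
    rw [← heq] at hp' hpb' hPeq hdisj hlt
    rw [Finset.union_self] at hdisj
    rw [Finset.inter_self] at hlt
    refine Or.inr ⟨pivots Wf, hfI, ?_, pivots (Wf ⊓ Wg), hhI, ?_, pivots_mono inf_le_left,
      annInd a (Wf ⊓ Wg), hH, p, hp, p', hp', hPeq, ?_, Sstar, hdisj, hlt⟩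
    · rw [← finrank_eq_card_pivots, hf]
    · rw [← finrank_eq_card_pivots, hh]
    · intro i hi j hji hj hS
      rw [hpb i hi j hji.ne, hpb' i hi j hji.ne, hswap i hi j hj hS]

end Classification

lemma exists_dotProduct_eq {m n : ℕ} {c : Fin n → Fin m → ZMod 2}
    (hc : LinearIndependent (ZMod 2) c) (y : Fin n → ZMod 2) :
    ∃ a : Fin m → ZMod 2, ∀ k, c k ⬝ᵥ a = y k := by
  have hrank : (Matrix.of c).rank = n := by
    simpa using LinearIndependent.rank_matrix (M := Matrix.of c) hc
  have htop : LinearMap.range (Matrix.of c).mulVecLin = ⊤ := by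
    apply Submodule.eq_top_of_finrank_eq
    rw [← Matrix.rank, hrank]
    simp
  obtain ⟨a, ha⟩ := LinearMap.range_eq_top.1 htop y
  exact ⟨a, fun k => congrFun ha k⟩

lemma finrank_span_image_finset {m n : ℕ} {c : Fin n → Fin m → ZMod 2}
    (hc : LinearIndependent (ZMod 2) c) (K : Finset (Fin n)) :
    Module.finrank (ZMod 2) (Submodule.span (ZMod 2) (c '' ↑K)) = K.card := by
  have h := finrank_span_eq_card (hc.comp (fun k : K => k.1) Subtype.val_injective)
  rw [Set.range_comp, Subtype.range_coe_subtype, Fintype.card_coe] at h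
  exact h

/-- characterization of Type I codewords of weight `w_μ`. -/
theorem stmt1 (m r μ : ℕ) (I : Finset (Finset (Fin m)))
    (hI : Decreasing I)
    (hmax : ∀ T ∈ I, T.card ≤ r) (hex : ∃ T ∈ I, T.card = r)
    (htop : (Finset.univ.filter fun i : Fin m => (i : ℕ) = m - 1) ∈ I)
    (hμ3 : 3 ≤ μ) (hμr : μ ≤ r) (hrm : μ ≤ m - r)
    (P : BF m) (hP : P ∈ code I)
    (hwt : wt P = 2 ^ (m + 1 - r) - 2 ^ (m + 1 - r - μ))
    (c : Fin (r + μ) → Fin m → ZMod 2) (d : Fin (r + μ) → ZMod 2)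
    (hind : LinearIndependent (ZMod 2) c)
    (hform : P =
      (∏ k ∈ Finset.univ.filter (fun k : Fin (r + μ) => (k : ℕ) < r - μ),
          ((fun v => (∑ j, c k j * v j) + d k) : BF m)) *
        ((∏ k ∈ Finset.univ.filter
              (fun k : Fin (r + μ) => r - μ ≤ (k : ℕ) ∧ (k : ℕ) < r),
            ((fun v => (∑ j, c k j * v j) + d k) : BF m)) +
          (∏ k ∈ Finset.univ.filter (fun k : Fin (r + μ) => r ≤ (k : ℕ)),
            ((fun v => (∑ j, c k j * v j) + d k) : BF m)))) :
    -- (A)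
    (∃ Sf ∈ I, ∃ Sg ∈ I, ∃ Sh ∈ I, Sf.card = r ∧ Sg.card = r ∧
      Sh.card = r - μ ∧ Sh ⊆ Sf ∩ Sg ∧
      P ∈ orbitSub Sh Sh * (orbitSub Sf (Sf \ Sh) + orbitSub Sg (Sg \ Sh)) ∧
      -- (A.1)
      (Sh = Sf ∩ Sg ∨
        -- (A.2)
        (((Sf ∩ Sg) \ Sh).Nonempty ∧
          ∃ Sstar : Finset (Fin m), Disjoint Sstar (Sf ∪ Sg) ∧
            shLT Sstar ((Sf ∩ Sg) \ Sh)))) ∨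
    -- (B)
    (∃ Sf : Finset (Fin m), Sf ∉ I ∧ Sf.card = r ∧
      ∃ Sh ∈ I, Sh.card = r - μ ∧ Sh ⊆ Sf ∧
      ∃ H ∈ orbitSub Sh Sh, ∃ p ∈ LTAsub Sf, ∃ p' ∈ LTAsub Sf,
        P = H * (act p.1 p.2 (Sf \ Sh) + act p'.1 p'.2 (Sf \ Sh)) ∧
        (∀ i ∈ Sf, ∀ j, j < i → j ∉ Sf → insert j (Sf.erase i) ∉ I →
          p.1 i j = p'.1 i j) ∧
        ∃ Sstar : Finset (Fin m), Disjoint Sstar Sf ∧ shLT Sstar (Sf \ Sh)) := by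
  classical
  set Kh := Finset.univ.filter fun k : Fin (r + μ) => (k : ℕ) < r - μ with hKh
  set Kf := Finset.univ.filter fun k : Fin (r + μ) => r - μ ≤ (k : ℕ) ∧ (k : ℕ) < r with hKf
  set Kg := Finset.univ.filter fun k : Fin (r + μ) => r ≤ (k : ℕ) with hKg
  have hch : Kh.card = r - μ := by
    rw [hKh, Fin.card_filter_val_lt]
    omega
  have hchf : (Kh ∪ Kf).card = r := by
    have : Kh ∪ Kf = Finset.univ.filter fun k : Fin (r + μ) => (k : ℕ) < r := by
      ext k
      simp only [hKh, hKf, Finset.mem_union, Finset.mem_filter, Finset.mem_univ, true_and]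
      omega
    rw [this, Fin.card_filter_val_lt]
    omega
  have hcg : Kg.card = μ := by
    have : Kg = Finset.univ \ Finset.univ.filter fun k : Fin (r + μ) => (k : ℕ) < r := by
      ext k
      simp [hKg]
    rw [this, Finset.card_sdiff_of_subset (Finset.subset_univ _), Fin.card_filter_val_lt]
    simp
  have hchg : (Kh ∪ Kg).card = r := by
    rw [Finset.card_union_of_disjoint, hch, hcg]
    · omega
    · rw [Finset.disjoint_filter]
      intro k _ h1 h2
      omega
  have huniv : Kh ∪ Kf ∪ (Kh ∪ Kg) = Finset.univ := by
    ext k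
    simp only [hKh, hKf, hKg, Finset.mem_union, Finset.mem_filter, Finset.mem_univ, true_and,
      iff_true]
    omega
  obtain ⟨a, ha⟩ := exists_dotProduct_eq hind fun k => d k + 1
  have hf := finrank_span_image_finset hind (Kh ∪ Kf)
  have hg := finrank_span_image_finset hind (Kh ∪ Kg)
  have hsup := finrank_span_image_finset hind Finset.univ
  rw [prod_affine_eq_annInd _ fun k _ => ha k, prod_affine_eq_annInd _ fun k _ => ha k,
    prod_affine_eq_annInd _ fun k _ => ha k, mul_add, annInd_mul, annInd_mul,
    ← Submodule.span_union, ← Submodule.span_union, ← Set.image_union, ← Set.image_union,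
    ← Finset.coe_union, ← Finset.coe_union] at hform
  rw [← huniv, Finset.coe_union, Set.image_union, Submodule.span_union, huniv,
    Finset.card_univ, Fintype.card_fin] at hsup
  have hsum := Submodule.finrank_sup_add_finrank_inf_eq
    (Submodule.span (ZMod 2) (c '' ↑(Kh ∪ Kf))) (Submodule.span (ZMod 2) (c '' ↑(Kh ∪ Kg)))
  rw [hchf] at hf
  rw [hchg] at hg
  rw [hsup, hf, hg] at hsum
  subst hform
  refine classification hI hP hf hg (by omega) fun he => ?_
  rw [he, inf_idem, hg] at hsum
  omega
end

section
/- Let I be a decreasing family of finsets of Fin m with r = max_{T ∈ I} |T|, and let S_f, S_g ∈ I_r. Assume either (1) S_f ≠ S_g and the two largest elements of the symmetric difference (S_f ∪ S_g) \ (S_f ∩ S_g) either both lie in S_f or both lie in S_g; or (2) |S_f ∩ S_g| < r − 2. Then |LTA(m,2)·x^{S_f} + LTA(m,2)·x^{S_g}| = |LTA(m,2)·x^{S_f}| · |LTA(m,2)·x^{S_g}|, where the sum is the Minkowski sum of sets of Boolean functions. -/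
open Pointwise

/-- `F` is the indicator of an affine subspace of `𝔽₂^m` in which, reading coordinates in
increasing order, those in `S` are determined by the previous ones and the others are free. -/
structure IsTriangular {m : ℕ} (S : Finset (Fin m)) (F : BF m) : Prop where
  affine : ∀ {u v w}, F u = 1 → F v = 1 → F w = 1 → F (u + v + w) = 1
  determined : ∀ {s u v}, s ∈ S → F u = 1 → F v = 1 → (∀ j < s, u j = v j) → u s = v s
  free : ∀ {c u}, c ∉ S → F u = 1 → ∃ v, F v = 1 ∧ (∀ j < c, v j = u j) ∧ v c = u c + 1

theorem prod_eq_one_iff_zmod_two {ι : Type*} (S : Finset ι) (f : ι → ZMod 2) :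
    ∏ i ∈ S, f i = 1 ↔ ∀ i ∈ S, f i = 1 := by
  refine ⟨fun h i hi => ?_, Finset.prod_eq_one⟩
  have hne : f i ≠ 0 := fun h0 => by simp [Finset.prod_eq_zero hi h0] at h
  generalize f i = a at hne
  revert a
  decide

theorem act_eq_one_iff {m : ℕ} (B : Fin m → Fin m → ZMod 2) (ε : Fin m → ZMod 2)
    (S : Finset (Fin m)) (v : Fin m → ZMod 2) :
    act B ε S v = 1 ↔ ∀ i ∈ S, v i + (∑ j, B i j * v j) + ε i = 1 :=
  prod_eq_one_iff_zmod_two _ _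

/-- A recursion in which the value at `i` only depends on the values at `j < i` has a
solution. -/
theorem exists_eq_of_causal {m : ℕ} {α : Type*} [Inhabited α] (φ : Fin m → (Fin m → α) → α)
    (hφ : ∀ i u v, (∀ j < i, u j = v j) → φ i u = φ i v) :
    ∃ w : Fin m → α, ∀ i, w i = φ i w := by
  let step (i : Fin m) (f : ∀ j, j < i → α) : α :=
    φ i fun j => if h : j < i then f j h else default
  refine ⟨(wellFounded_lt (α := Fin m)).fix step, fun i => ?_⟩
  rw [WellFounded.fix_eq]
  exact hφ _ _ _ fun j hj => dif_pos hj

theorem sum_mul_congr_of_lower {m : ℕ} {B : Fin m → Fin m → ZMod 2}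
    (hB : ∀ i j, B i j ≠ 0 → j < i) {i : Fin m} {u v : Fin m → ZMod 2}
    (h : ∀ j < i, u j = v j) : ∑ j, B i j * u j = ∑ j, B i j * v j := by
  refine Finset.sum_congr rfl fun j _ => ?_
  by_cases h0 : B i j = 0
  · simp [h0]
  · rw [h j (hB i j h0)]

theorem isTriangular_of_mem_orbitFull {m : ℕ} {S : Finset (Fin m)} {F : BF m}
    (hF : F ∈ orbitFull S) : IsTriangular S F := by
  obtain ⟨B, ε, hB, rfl⟩ := hF
  have h2 : (2 : ZMod 2) = 0 := rfl
  refine ⟨fun {u v w} hu hv hw => ?_, fun {s u v} hs hu hv h => ?_, fun {c u} hc hu => ?_⟩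
  · rw [act_eq_one_iff] at *
    intro i hi
    simp only [Pi.add_apply, mul_add, Finset.sum_add_distrib]
    linear_combination hu i hi + hv i hi + hw i hi - (ε i - 1) * h2
  · rw [act_eq_one_iff] at hu hv
    have hu := hu s hs
    rw [sum_mul_congr_of_lower hB h, ← hv s hs] at hu
    exact add_right_cancel (add_right_cancel hu)
  · obtain ⟨v, hv⟩ := exists_eq_of_causal
      (fun i v => if i < c then u i else if i = c then u c + 1 else
        1 + (∑ j, B i j * v j) + ε i)
      (fun i v w h => by simp only [sum_mul_congr_of_lower hB h])
    have hlt : ∀ j < c, v j = u j := fun j hj => by rw [hv, if_pos hj]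
    refine ⟨v, ?_, hlt, by rw [hv]; simp⟩
    rw [act_eq_one_iff] at hu ⊢
    intro i hi
    by_cases hic : i < c
    · rw [hlt i hic, sum_mul_congr_of_lower hB fun j hj => hlt j (hj.trans hic)]
      exact hu i hi
    · have hvi := hv i
      rw [if_neg hic, if_neg (fun h : i = c => hc (h ▸ hi))] at hvi
      linear_combination hvi + ((∑ j, B i j * v j) + ε i) * h2

section

variable {m : ℕ} {Sf Sg : Finset (Fin m)} {P P' Q Q' : BF m}

theorem IsTriangular.false_of_eq_add_one (hQ : IsTriangular Sg Q) {s : Fin m} (hs : s ∈ Sg)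
    {u v : Fin m → ZMod 2} (hu : Q u = 1) (hv : Q v = 1) (h : ∀ j < s, u j = v j)
    (hne : u s = v s + 1) : False := by
  rw [hQ.determined hs hu hv h] at hne
  simp at hne

/-- The first coordinate at which `u` and `v` differ lies in `S`. -/
def FirstDifferIn {m : ℕ} (S : Finset (Fin m)) (u v : Fin m → ZMod 2) : Prop :=
  ∃ s ∈ S, (∀ j < s, u j = v j) ∧ u s = v s + 1

theorem FirstDifferIn.not_both {u v : Fin m → ZMod 2} (h : FirstDifferIn Sg u v)
    (hQ : IsTriangular Sg Q) (hu : Q u = 1) (hv : Q v = 1) : False := by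
  obtain ⟨s, hs, hlt, hne⟩ := h
  exact hQ.false_of_eq_add_one hs hu hv hlt hne

theorem eq_one_or_eq_one_of_add_eq_add {a b c d : ZMod 2} (h : a + c = b + d)
    (ha : a = 1) (hb : b ≠ 1) : c = 1 ∨ d = 1 := by
  revert a b c d
  decide

theorem IsTriangular.eq_one_of_line (hP' : IsTriangular Sf P') {x u v : Fin m → ZMod 2}
    (hu : P' u = 1) (hv : P' v = 1) (huv : P' (u + v + x) = 1) : P' x = 1 := by
  convert hP'.affine hu hv huv using 2
  ext j
  simp only [Pi.add_apply]
  generalize u j = a, v j = b, x j = c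
  revert a b c
  decide

/-- If two elements `b < a` of `Sf` are outside `Sg`, then `Q` and `Q'` impose the same
conditions on the coordinates below `b`. -/
theorem exists_eq_one_agreeing_below (hP : IsTriangular Sf P) (hP' : IsTriangular Sf P')
    (hQ' : IsTriangular Sg Q') (h : ∀ v, P v + Q v = P' v + Q' v)
    {a b : Fin m} (ha : a ∈ Sf) (hb : b ∈ Sf) (ha' : a ∉ Sg) (hb' : b ∉ Sg) (hba : b < a)
    {v : Fin m → ZMod 2} (hv : Q' v = 1) : ∃ y, Q y = 1 ∧ ∀ j < b, y j = v j := by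
  by_contra! hcon
  obtain ⟨y, hy, hylt, hyb⟩ := hQ'.free hb' hv
  obtain ⟨z, hz, hzlt, hza⟩ := hQ'.free ha' hv
  have mem {w : Fin m → ZMod 2} (hw : Q' w = 1) (hwlt : ∀ j < b, w j = v j) :
      P' w = 1 ∨ P w = 1 := by
    refine eq_one_or_eq_one_of_add_eq_add (a := Q' w) (b := Q w) ?_ hw fun hQw => ?_
    · rw [add_comm, ← h, add_comm]
    · obtain ⟨j, hj, hne⟩ := hcon w hQw
      exact hne (hwlt j hj)
  have sep {F : BF m} (hF : IsTriangular Sf F) :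
      ¬(F y = 1 ∧ F v = 1) ∧ ¬(F z = 1 ∧ F v = 1) ∧ ¬(F y = 1 ∧ F z = 1) := by
    refine ⟨fun ⟨h1, h2⟩ => hF.false_of_eq_add_one hb h1 h2 hylt hyb,
      fun ⟨h1, h2⟩ => hF.false_of_eq_add_one ha h1 h2 hzlt hza,
      fun ⟨h1, h2⟩ => hF.false_of_eq_add_one hb h1 h2 (fun j hj => ?_) ?_⟩
    · rw [hylt j hj, hzlt j (hj.trans hba)]
    · rw [hyb, hzlt b hba]
  have mv := mem hv fun _ _ => rfl
  have my := mem hy hylt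
  have mz := mem hz fun j hj => hzlt j (hj.trans hba)
  have s1 := sep hP
  have s2 := sep hP'
  tauto

theorem eq_one_of_two_largest (hP : IsTriangular Sf P) (hP' : IsTriangular Sf P')
    (hQ : IsTriangular Sg Q) (hQ' : IsTriangular Sg Q') (h : ∀ v, P v + Q v = P' v + Q' v)
    {a b c d : Fin m} (ha : a ∈ Sf \ Sg) (hb : b ∈ Sf \ Sg) (hba : b < a)
    (hc : c ∈ Sg \ Sf) (hd : d ∈ Sg \ Sf) (hcd : c < d) (hdb : d < b)
    {x : Fin m → ZMod 2} (hx : P x = 1) : P' x = 1 := by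
  simp only [Finset.mem_sdiff] at ha hb hc hd
  by_contra hx'
  have lift {z : Fin m → ZMod 2} (hz : P z = 1) (hz' : P' z ≠ 1) :
      ∃ y, Q y = 1 ∧ ∀ j < b, y j = z j :=
    (eq_one_or_eq_one_of_add_eq_add (h z) hz hz').elim (fun hQz => ⟨z, hQz, fun _ _ => rfl⟩)
      (exists_eq_one_agreeing_below hP hP' hQ' h ha.1 hb.1 ha.2 hb.2 hba)
  obtain ⟨q, hq, hqlt⟩ := lift hx hx'
  have mem {z : Fin m → ZMod 2} {s : Fin m} (hs : s ∈ Sg) (hsb : s < b) (hz : P z = 1)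
      (hlt : ∀ j < s, z j = x j) (hne : z s = x s + 1) : P' z = 1 := by
    by_contra hz'
    obtain ⟨y, hy, hylt⟩ := lift hz hz'
    refine hQ.false_of_eq_add_one hs hy hq (fun j hj => ?_) ?_
    · rw [hylt j (hj.trans hsb), hqlt j (hj.trans hsb), hlt j hj]
    · rw [hylt s hsb, hqlt s hsb, hne]
  obtain ⟨u, hu, hult, huc⟩ := hP.free hc.2 hx
  obtain ⟨v, hv, hvlt, hvd⟩ := hP.free hd.2 hx
  refine hx' (hP'.eq_one_of_line (mem hc.1 (hcd.trans hdb) hu hult huc) (mem hd.1 hdb hv hvlt hvd)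
    (mem hc.1 (hcd.trans hdb) (hP.affine hu hv hx) (fun j hj => ?_) ?_))
  · simp [hult j hj, hvlt j (hj.trans hcd), CharTwo.add_self_eq_zero]
  · simp [huc, hvlt c hcd, add_assoc, CharTwo.add_self_eq_zero]

theorem eq_one_of_three_le (hP : IsTriangular Sf P) (hP' : IsTriangular Sf P')
    (hQ : IsTriangular Sg Q) (hQ' : IsTriangular Sg Q') (h : ∀ v, P v + Q v = P' v + Q' v)
    {c d e : Fin m} (hc : c ∈ Sg \ Sf) (hd : d ∈ Sg \ Sf) (he : e ∈ Sg \ Sf)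
    (hcd : c < d) (hde : d < e) {x : Fin m → ZMod 2} (hx : P x = 1) : P' x = 1 := by
  simp only [Finset.mem_sdiff] at hc hd he
  by_contra hx'
  obtain ⟨u, hu, hult, huc⟩ := hP.free hc.2 hx
  obtain ⟨v, hv, hvlt, hvd⟩ := hP.free hd.2 hx
  obtain ⟨w, hw, hwlt, hwe⟩ := hP.free he.2 hx
  have huv := hP.affine hu hv hx
  have huw := hP.affine hu hw hx
  have hvw := hP.affine hv hw hx
  have hce := hcd.trans hde
  have hvc := hvlt c hcd
  have hwc := hwlt c hce
  have hwd := hwlt d hde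
  have vlt : ∀ j < c, v j = x j := fun j hj => hvlt j (hj.trans hcd)
  have wlt : ∀ j < c, w j = x j := fun j hj => hwlt j (hj.trans hce)
  have wlt' : ∀ j < d, w j = x j := fun j hj => hwlt j (hj.trans hde)
  have char_two (t : ZMod 2) : t + t = 0 := CharTwo.add_self_eq_zero t
  have sux : FirstDifferIn Sg u x := ⟨c, hc.1, hult, huc⟩
  have svx : FirstDifferIn Sg v x := ⟨d, hd.1, hvlt, hvd⟩
  have swx : FirstDifferIn Sg w x := ⟨e, he.1, hwlt, hwe⟩
  have suvx : FirstDifferIn Sg (u + v + x) x := ⟨c, hc.1, by grind [Pi.add_apply],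
    by grind [Pi.add_apply]⟩
  have suwx : FirstDifferIn Sg (u + w + x) x := ⟨c, hc.1, by grind [Pi.add_apply],
    by grind [Pi.add_apply]⟩
  have svwx : FirstDifferIn Sg (v + w + x) x := ⟨d, hd.1, by grind [Pi.add_apply],
    by grind [Pi.add_apply]⟩
  have svu : FirstDifferIn Sg v u := ⟨c, hc.1, by grind, by grind⟩
  have swu : FirstDifferIn Sg w u := ⟨c, hc.1, by grind, by grind⟩
  have svwu : FirstDifferIn Sg (v + w + x) u := ⟨c, hc.1, by grind [Pi.add_apply],
    by grind [Pi.add_apply]⟩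
  have suv : FirstDifferIn Sg u v := ⟨c, hc.1, by grind, by grind⟩
  have swv : FirstDifferIn Sg w v := ⟨d, hd.1, by grind, by grind⟩
  have suwv : FirstDifferIn Sg (u + w + x) v := ⟨c, hc.1, by grind [Pi.add_apply],
    by grind [Pi.add_apply]⟩
  have swuv : FirstDifferIn Sg w (u + v + x) := ⟨c, hc.1, by grind [Pi.add_apply],
    by grind [Pi.add_apply]⟩
  have suwuv : FirstDifferIn Sg (u + w + x) (u + v + x) := ⟨d, hd.1, by grind [Pi.add_apply],
    by grind [Pi.add_apply]⟩
  have mem {u v} (hu : P u = 1) (hv : P v = 1) (hu' : P' u ≠ 1) (hux : FirstDifferIn Sg u x)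
      (hvx : FirstDifferIn Sg v x) (hvu : FirstDifferIn Sg v u) : P' v = 1 := by
    by_contra hv'
    rcases eq_one_or_eq_one_of_add_eq_add (h x) hx hx' with mx | mx <;>
      rcases eq_one_or_eq_one_of_add_eq_add (h u) hu hu' with mu | mu <;>
      rcases eq_one_or_eq_one_of_add_eq_add (h v) hv hv' with mv | mv
    exacts [hux.not_both hQ mu mx, hux.not_both hQ mu mx, hvx.not_both hQ mv mx,
      hvu.not_both hQ' mv mu, hvu.not_both hQ mv mu, hvx.not_both hQ' mv mx,
      hux.not_both hQ' mu mx, hux.not_both hQ' mu mx]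
  by_cases hu' : P' u = 1
  · by_cases hv' : P' v = 1
    · have huv' : P' (u + v + x) ≠ 1 := fun h' => hx' (hP'.eq_one_of_line hu' hv' h')
      exact hx' (hP'.eq_one_of_line hu' (mem huv hw huv' suvx swx swuv)
        (mem huv huw huv' suvx suwx suwuv))
    · exact hx' (hP'.eq_one_of_line hu' (mem hv hw hv' svx swx swv)
        (mem hv huw hv' svx suwx suwv))
  · exact hx' (hP'.eq_one_of_line (mem hu hv hu' sux svx svu) (mem hu hw hu' sux swx swu)
      (mem hu hvw hu' sux svwx svwu))

theorem eq_of_eq_one_iff {F G : BF m} (h : ∀ v, F v = 1 ↔ G v = 1) : F = G := by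
  funext v
  have hv := h v
  generalize F v = a, G v = b at hv
  revert a b
  decide

theorem eq_of_two_largest (hP : IsTriangular Sf P) (hP' : IsTriangular Sf P')
    (hQ : IsTriangular Sg Q) (hQ' : IsTriangular Sg Q') (h : ∀ v, P v + Q v = P' v + Q' v)
    (hcard : Sf.card = Sg.card) {a b : Fin m} (ha : a ∈ Sf \ Sg) (hb : b ∈ Sf \ Sg)
    (hba : b < a) (hmax : ∀ x ∈ Sg \ Sf, x ≤ b) : P = P' := by
  have hc : 1 < (Sg \ Sf).card := by
    rw [← Finset.card_sdiff_comm hcard]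
    exact Finset.one_lt_card.2 ⟨b, hb, a, ha, hba.ne⟩
  have hlt : ∀ x ∈ Sg \ Sf, x < b := fun x hx => (hmax x hx).lt_of_ne <| by
    rintro rfl
    exact (Finset.mem_sdiff.1 hb).2 (Finset.mem_sdiff.1 hx).1
  let c := (Sg \ Sf).orderEmbOfFin rfl
  have hmem := (Sg \ Sf).orderEmbOfFin_mem rfl
  have hcd : c ⟨0, by omega⟩ < c ⟨1, hc⟩ := c.strictMono (by simp)
  exact eq_of_eq_one_iff fun x =>
    ⟨eq_one_of_two_largest hP hP' hQ hQ' h ha hb hba (hmem _) (hmem _) hcd (hlt _ (hmem _)),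
      eq_one_of_two_largest hP' hP hQ' hQ (fun v => (h v).symm) ha hb hba (hmem _) (hmem _) hcd
        (hlt _ (hmem _))⟩

theorem eq_of_three_le (hP : IsTriangular Sf P) (hP' : IsTriangular Sf P')
    (hQ : IsTriangular Sg Q) (hQ' : IsTriangular Sg Q') (h : ∀ v, P v + Q v = P' v + Q' v)
    (hc : 2 < (Sg \ Sf).card) : P = P' := by
  let c := (Sg \ Sf).orderEmbOfFin rfl
  have hmem := (Sg \ Sf).orderEmbOfFin_mem rfl
  have hcd : c ⟨0, by omega⟩ < c ⟨1, by omega⟩ := c.strictMono (by simp)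
  have hde : c ⟨1, by omega⟩ < c ⟨2, hc⟩ := c.strictMono (by simp)
  exact eq_of_eq_one_iff fun x =>
    ⟨eq_one_of_three_le hP hP' hQ hQ' h (hmem _) (hmem _) (hmem _) hcd hde,
      eq_one_of_three_le hP' hP hQ' hQ (fun v => (h v).symm) (hmem _) (hmem _) (hmem _) hcd hde⟩

end

/-- if either (1) `S_f ≠ S_g` and the two largest elements of the
symmetric difference both lie in `S_f` or both lie in `S_g`, or
(2) `|S_f ∩ S_g| < r − 2`, then the Minkowski sum of full orbits has cardinality
equal to the product of the cardinalities. -/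
theorem stmt2 (m r : ℕ) (I : Finset (Finset (Fin m))) (hI : Decreasing I)
    (hmax : ∀ T ∈ I, T.card ≤ r) (hex : ∃ T ∈ I, T.card = r)
    (Sf Sg : Finset (Fin m)) (hf : Sf ∈ I) (hfc : Sf.card = r)
    (hg : Sg ∈ I) (hgc : Sg.card = r)
    (hcond :
      (Sf ≠ Sg ∧ ∃ a ∈ (Sf ∪ Sg) \ (Sf ∩ Sg), ∃ b ∈ (Sf ∪ Sg) \ (Sf ∩ Sg),
        b < a ∧ (∀ x ∈ (Sf ∪ Sg) \ (Sf ∩ Sg), x = a ∨ x ≤ b) ∧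
        ((a ∈ Sf ∧ b ∈ Sf) ∨ (a ∈ Sg ∧ b ∈ Sg))) ∨
      (Sf ∩ Sg).card < r - 2) :
    (orbitFull Sf + orbitFull Sg).ncard =
      (orbitFull Sf).ncard * (orbitFull Sg).ncard := by
  rw [← Set.ncard_prod, ← Set.add_image_prod]
  refine Set.InjOn.ncard_image ?_
  rintro ⟨P, Q⟩ ⟨hP, hQ⟩ ⟨P', Q'⟩ ⟨hP', hQ'⟩ heq
  replace hP := isTriangular_of_mem_orbitFull hP
  replace hQ := isTriangular_of_mem_orbitFull hQ
  replace hP' := isTriangular_of_mem_orbitFull hP'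
  replace hQ' := isTriangular_of_mem_orbitFull hQ'
  simp only at heq hP hQ hP' hQ'
  have h : ∀ v, P v + Q v = P' v + Q' v := congrFun heq
  suffices P = P' ∨ Q = Q' by
    rcases this with rfl | rfl
    · rw [add_left_cancel heq]
    · rw [add_right_cancel heq]
  rcases hcond with ⟨-, a, ha, b, hb, hba, hmax', hab⟩ | hcard
  · have hle {S T : Finset (Fin m)} (haS : a ∉ S)
        (hsub : S \ T ⊆ (Sf ∪ Sg) \ (Sf ∩ Sg)) : ∀ x ∈ S \ T, x ≤ b := fun x hx =>
      (hmax' x (hsub hx)).resolve_left fun hxa => haS (hxa ▸ (Finset.mem_sdiff.1 hx).1)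
    rcases hab with ⟨haS, hbS⟩ | ⟨haS, hbS⟩
    · exact .inl <| eq_of_two_largest hP hP' hQ hQ' h (hfc.trans hgc.symm) (by grind) (by grind)
        hba (hle (by grind) (by grind))
    · exact .inr <| eq_of_two_largest hQ hQ' hP hP' (fun v => by rw [add_comm, h, add_comm])
        (hgc.trans hfc.symm) (by grind) (by grind) hba (hle (by grind) (by grind))
  · have := Finset.card_sdiff_add_card_inter Sg Sf
    rw [Finset.inter_comm] at this
    exact .inl <| eq_of_three_le hP hP' hQ hQ' h (by omega)
end

section
/- Let I be a decreasing family of finsets of Fin m with r = max_{T ∈ I} |T|, let S_f, S_g ∈ I_r, and set S_h = S_f ∩ S_g and s = r − |S_h|, with s ≥ 2. Let i_1 < … < i_s be the increasing enumeration of S_f \ S_h and j_1 < … < j_s that of S_g \ S_h, and assume i_s > i_{s−1} > j_s or j_s > j_{s−1} > i_s. Then |LTA(m,2)·x^{S_f} + LTA(m,2)·x^{S_g}| = |LTA(m,2)·x^{S_f}| · |LTA(m,2)·x^{S_g}|, where the sum is the Minkowski sum of sets of Boolean functions. -/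
open Pointwise

/-- `g` is an affine function of the variables of index less than `n`. -/
def IsAffineBelow {m : ℕ} (n : ℕ) (g : BF m) : Prop :=
  ∃ (b : Fin m → ZMod 2) (ε : ZMod 2),
    (∀ j, b j ≠ 0 → (j : ℕ) < n) ∧ g = fun v => (∑ j, b j * v j) + ε

/-- `f` is affine with leading variable `i`. -/
def HasLead {m : ℕ} (i : Fin m) (f : BF m) : Prop :=
  ∃ g, IsAffineBelow i g ∧ f = (fun v => v i) + g

/-- The partial derivative of a Boolean function in the variable `t`. -/
def deriv₂ {m : ℕ} (t : Fin m) (f : BF m) : BF m :=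
  fun v => f (Function.update v t 1) + f (Function.update v t 0)

namespace IsAffineBelow

variable {m : ℕ}

theorem add {n : ℕ} {f g : BF m} (hf : IsAffineBelow n f) (hg : IsAffineBelow n g) :
    IsAffineBelow n (f + g) := by
  obtain ⟨b, ε, hb, rfl⟩ := hf
  obtain ⟨c, δ, hc, rfl⟩ := hg
  refine ⟨b + c, ε + δ, fun j hj => ?_, ?_⟩
  · by_contra hjn
    have h1 : b j = 0 := by_contra fun h => hjn (hb j h)
    have h2 : c j = 0 := by_contra fun h => hjn (hc j h)
    exact hj (by simp [h1, h2])
  · funext v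
    simp only [Pi.add_apply, add_mul, Finset.sum_add_distrib]
    ring

theorem one (n : ℕ) : IsAffineBelow n (1 : BF m) :=
  ⟨0, 1, by simp, by funext v; simp⟩

theorem update_eq {n : ℕ} {f : BF m} (hf : IsAffineBelow n f) {t : Fin m} (ht : n ≤ t)
    (v : Fin m → ZMod 2) (a : ZMod 2) : f (Function.update v t a) = f v := by
  obtain ⟨b, ε, hb, rfl⟩ := hf
  have hbt : b t = 0 := by_contra fun h => absurd (hb t h) (by omega)
  dsimp only
  congr 1
  refine Finset.sum_congr rfl fun j _ => ?_
  by_cases hj : j = t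
  · subst hj; simp [hbt]
  · rw [Function.update_of_ne hj]

theorem eq_zero_or_eq_one {f : BF m} (hf : IsAffineBelow 0 f) : f = 0 ∨ f = 1 := by
  obtain ⟨b, ε, hb, rfl⟩ := hf
  have hb0 : ∀ j, b j = 0 := fun j => by_contra fun h => absurd (hb j h) (by omega)
  have hε : ∀ e : ZMod 2, e = 0 ∨ e = 1 := by decide
  rcases hε ε with rfl | rfl
  · left; funext v; simp [hb0]
  · right; funext v; simp [hb0]

theorem of_succ {n : ℕ} {f : BF m} (hf : IsAffineBelow (n + 1) f) :
    IsAffineBelow n f ∨ ∃ k : Fin m, (k : ℕ) = n ∧ HasLead k f := by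
  obtain ⟨b, ε, hb, rfl⟩ := hf
  by_cases h : ∃ k : Fin m, (k : ℕ) = n ∧ b k ≠ 0
  · obtain ⟨k, rfl, hbk⟩ := h
    have h1 : ∀ e : ZMod 2, e ≠ 0 → e = 1 := by decide
    right
    refine ⟨k, rfl, _, ⟨Function.update b k 0, ε, fun j hj => ?_, rfl⟩, ?_⟩
    · have hjk : j ≠ k := by rintro rfl; simp at hj
      rw [Function.update_of_ne hjk] at hj
      have := hb j hj
      have : (j : ℕ) ≠ k := fun h => hjk (Fin.ext h)
      omega
    · funext v
      simp only [Pi.add_apply]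
      rw [← Finset.add_sum_erase _ _ (Finset.mem_univ k),
        ← Finset.add_sum_erase Finset.univ (fun j => Function.update b k 0 j * v j)
          (Finset.mem_univ k), h1 _ hbk]
      have : ∑ j ∈ Finset.univ.erase k, Function.update b k 0 j * v j
          = ∑ j ∈ Finset.univ.erase k, b j * v j :=
        Finset.sum_congr rfl fun j hj => by
          rw [Function.update_of_ne (Finset.ne_of_mem_erase hj)]
      rw [this]
      simp [add_assoc]
  · left
    push Not at h
    refine ⟨b, ε, fun j hj => ?_, rfl⟩
    have := hb j hj
    have : (j : ℕ) ≠ n := fun e => hj (h j e)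
    omega

end IsAffineBelow

section Orbits

variable {m : ℕ}

theorem add_self_bf (f : BF m) : f + f = 0 := funext fun v => CharTwo.add_self_eq_zero (f v)

theorem eq_of_add_eq_zero_bf {f g : BF m} (h : f + g = 0) : f = g :=
  funext fun v => CharTwo.add_eq_zero.mp (congrFun h v)

theorem HasLead.update_eq {i t : Fin m} {f : BF m} (hf : HasLead i f) (hit : i < t)
    (v : Fin m → ZMod 2) (a : ZMod 2) : f (Function.update v t a) = f v := by
  obtain ⟨g, hg, rfl⟩ := hf
  simp only [Pi.add_apply]
  rw [hg.update_eq (Fin.lt_def.mp hit).le, Function.update_of_ne hit.ne]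

theorem HasLead.add_isAffineBelow {i : Fin m} {f g : BF m} (hf : HasLead i f)
    (hg : HasLead i g) : IsAffineBelow i (f + g) := by
  obtain ⟨f, hf, rfl⟩ := hf
  obtain ⟨g, hg, rfl⟩ := hg
  have : (fun v : Fin m → ZMod 2 => v i) + f + ((fun v => v i) + g) = f + g := by
    rw [add_add_add_comm, add_self_bf, zero_add]
  rw [this]
  exact hf.add hg

theorem mem_orbitFull_iff {S : Finset (Fin m)} {F : BF m} :
    F ∈ orbitFull S ↔ ∃ l : Fin m → BF m, (∀ i, HasLead i (l i)) ∧ F = ∏ i ∈ S, l i := by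
  constructor
  · rintro ⟨B, ε, hB, rfl⟩
    refine ⟨fun i v => v i + (∑ j, B i j * v j) + ε i, fun i => ?_, ?_⟩
    · exact ⟨_, ⟨B i, ε i, fun j hj => hB i j hj, rfl⟩, by funext v; simp [add_assoc]⟩
    · funext v
      simp [act, Finset.prod_apply]
  · rintro ⟨l, hl, rfl⟩
    choose g hg hlg using hl
    choose B ε hB hgB using hg
    refine ⟨B, ε, fun i j h => hB i j h, ?_⟩
    funext v
    simp only [act, Finset.prod_apply]
    refine Finset.prod_congr rfl fun i _ => ?_
    rw [hlg i, hgB i]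
    simp [add_assoc]

theorem HasLead.mul_mem_orbitFull {S : Finset (Fin m)} {k : Fin m} {f A : BF m}
    (hf : HasLead k f) (hA : A ∈ orbitFull S) (hk : k ∉ S) :
    f * A ∈ orbitFull (insert k S) := by
  obtain ⟨l, hl, rfl⟩ := mem_orbitFull_iff.mp hA
  refine mem_orbitFull_iff.mpr ⟨Function.update l k f, fun i => ?_, ?_⟩
  · by_cases hi : i = k
    · subst hi; simpa using hf
    · simpa [hi] using hl i
  · rw [Finset.prod_insert hk, Function.update_self]
    congr 1
    refine Finset.prod_congr rfl fun i hi => ?_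
    rw [Function.update_of_ne (ne_of_mem_of_not_mem hi hk)]

theorem orbitFull_update_eq {S : Finset (Fin m)} {F : BF m} (hF : F ∈ orbitFull S)
    {t : Fin m} (ht : ∀ i ∈ S, i < t) (v : Fin m → ZMod 2) (a : ZMod 2) :
    F (Function.update v t a) = F v := by
  obtain ⟨l, hl, rfl⟩ := mem_orbitFull_iff.mp hF
  simp only [Finset.prod_apply]
  exact Finset.prod_congr rfl fun i hi => (hl i).update_eq (ht i hi) v a

theorem deriv₂_add (t : Fin m) (f g : BF m) :
    deriv₂ t (f + g) = deriv₂ t f + deriv₂ t g := by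
  funext v
  simp only [deriv₂, Pi.add_apply]
  ring

theorem deriv₂_eq_zero {S : Finset (Fin m)} {F : BF m} (hF : F ∈ orbitFull S)
    {t : Fin m} (ht : ∀ i ∈ S, i < t) : deriv₂ t F = 0 := by
  funext v
  simp only [deriv₂, orbitFull_update_eq hF ht]
  exact CharTwo.add_self_eq_zero _

/-- Factor the leading form off an element of the orbit. -/
theorem exists_lead_mul {S : Finset (Fin m)} {F : BF m} (hF : F ∈ orbitFull S)
    {t : Fin m} (htS : t ∈ S) (ht : ∀ i ∈ S, i ≤ t) :
    ∃ f A, HasLead t f ∧ A ∈ orbitFull (S.erase t) ∧ F = f * A ∧ deriv₂ t F = A := by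
  obtain ⟨l, hl, rfl⟩ := mem_orbitFull_iff.mp hF
  have hA : ∏ i ∈ S.erase t, l i ∈ orbitFull (S.erase t) :=
    mem_orbitFull_iff.mpr ⟨l, hl, rfl⟩
  have hFA : ∏ i ∈ S, l i = l t * ∏ i ∈ S.erase t, l i := (Finset.mul_prod_erase S l htS).symm
  refine ⟨l t, _, hl t, hA, hFA, ?_⟩
  have hlt : ∀ i ∈ S.erase t, i < t := fun i hi =>
    lt_of_le_of_ne (ht i (Finset.mem_of_mem_erase hi)) (Finset.ne_of_mem_erase hi)
  obtain ⟨g, hg, hlg⟩ := hl t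
  funext v
  rw [hFA]
  simp only [deriv₂, Pi.mul_apply, orbitFull_update_eq hA hlt]
  rw [hlg]
  simp only [Pi.add_apply, hg.update_eq le_rfl, Function.update_self]
  rw [← add_mul, zero_add, add_assoc, CharTwo.add_self_eq_zero, add_zero, one_mul]

theorem zero_notMem_orbitFull (S : Finset (Fin m)) : (0 : BF m) ∉ orbitFull S := by
  induction S using Finset.induction_on_max with
  | empty =>
    intro h
    obtain ⟨l, -, h⟩ := mem_orbitFull_iff.mp h
    exact zero_ne_one (congrFun h 0)
  | insert t S hS ih =>
    intro h
    obtain ⟨f, A, -, hA, -, hd⟩ := exists_lead_mul h (Finset.mem_insert_self t S)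
      (fun i hi => (Finset.mem_insert.mp hi).elim le_of_eq fun h => (hS i h).le)
    rw [Finset.erase_insert fun h => lt_irrefl t (hS t h)] at hA
    have : A = 0 := by
      rw [← hd]; funext v; simp [deriv₂]
    exact ih (this ▸ hA)

/-- Multiplying an orbit element by an affine function adds at most one variable
to its leading monomial. -/
theorem affine_mul_orbitFull {S : Finset (Fin m)} {A : BF m} (hA : A ∈ orbitFull S) (n : ℕ)
    {e : BF m} (he : IsAffineBelow n e) :
    e * A = 0 ∨ ∃ S' : Finset (Fin m),
      S ⊆ S' ∧ (S' \ S).card ≤ 1 ∧ e * A ∈ orbitFull S' := by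
  induction n generalizing e with
  | zero =>
    rcases he.eq_zero_or_eq_one with rfl | rfl
    · left; simp
    · exact .inr ⟨S, subset_rfl, by simp, by simpa using hA⟩
  | succ n ih =>
    rcases he.of_succ with he | ⟨k, rfl, hk⟩
    · exact ih he
    · by_cases hkS : k ∈ S
      · obtain ⟨l, hl, rfl⟩ := mem_orbitFull_iff.mp hA
        have hsq : ∀ a : ZMod 2, a * a = a := by decide
        have key : e * ∏ i ∈ S, l i = (e + l k + 1) * ∏ i ∈ S, l i := by
          rw [← Finset.mul_prod_erase S l hkS, ← mul_assoc, ← mul_assoc]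
          congr 1
          funext v
          simp only [Pi.mul_apply, Pi.add_apply, Pi.one_apply]
          rw [add_assoc, add_mul, add_mul, hsq, one_mul, CharTwo.add_self_eq_zero, add_zero]
        rw [key]
        exact ih ((hk.add_isAffineBelow (hl k)).add (.one _))
      · exact .inr ⟨_, Finset.subset_insert k S,
          by rw [Finset.insert_sdiff_cancel hkS, Finset.card_singleton],
          hk.mul_mem_orbitFull hA hkS⟩

theorem subset_of_mem_orbitFull {S T : Finset (Fin m)} {F : BF m} (hS : F ∈ orbitFull S)
    (hT : F ∈ orbitFull T) : S ⊆ T := by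
  induction hn : (S ∪ T).card using Nat.strong_induction_on generalizing S T F with
  | _ n ih =>
    rcases (S ∪ T).eq_empty_or_nonempty with h | h
    · rw [(Finset.union_eq_empty.mp h).1]; exact Finset.empty_subset _
    obtain ⟨t, htm, ht⟩ : ∃ t ∈ S ∪ T, ∀ i ∈ S ∪ T, i ≤ t :=
      ⟨_, Finset.max'_mem _ h, fun i hi => Finset.le_max' _ i hi⟩
    have hlS : ∀ i ∈ S, i ≤ t := fun i hi => ht i (Finset.mem_union_left _ hi)
    have hlT : ∀ i ∈ T, i ≤ t := fun i hi => ht i (Finset.mem_union_right _ hi)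
    have hlt : ∀ U : Finset (Fin m), (∀ i ∈ U, i ≤ t) → t ∉ U → ∀ i ∈ U, i < t :=
      fun U hU htU i hi => lt_of_le_of_ne (hU i hi) (ne_of_mem_of_not_mem hi htU)
    by_cases htS : t ∈ S <;> by_cases htT : t ∈ T
    · obtain ⟨-, A, -, hA, -, hdA⟩ := exists_lead_mul hS htS hlS
      obtain ⟨-, C, -, hC, -, hdC⟩ := exists_lead_mul hT htT hlT
      have hAC : A = C := hdA.symm.trans hdC
      have hcard : (S.erase t ∪ T.erase t).card < n := by
        rw [← hn, ← Finset.erase_union_distrib]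
        exact Finset.card_erase_lt_of_mem htm
      have := ih _ hcard hA (hAC ▸ hC) rfl
      intro i hi
      by_cases hit : i = t
      · exact hit ▸ htT
      · exact Finset.mem_of_mem_erase (this (Finset.mem_erase.mpr ⟨hit, hi⟩))
    · obtain ⟨-, A, -, hA, -, hdA⟩ := exists_lead_mul hS htS hlS
      rw [deriv₂_eq_zero hT (hlt T hlT htT)] at hdA
      exact absurd (hdA ▸ hA) (zero_notMem_orbitFull _)
    · obtain ⟨-, C, -, hC, -, hdC⟩ := exists_lead_mul hT htT hlT
      rw [deriv₂_eq_zero hS (hlt S hlS htS)] at hdC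
      exact absurd (hdC ▸ hC) (zero_notMem_orbitFull _)
    · exact absurd htm (by simp [htS, htT])

theorem affine_mul_eq_zero_of_eq {S T : Finset (Fin m)} {A C e e' : BF m} {n : ℕ}
    (hA : A ∈ orbitFull S) (hC : C ∈ orbitFull T) (he : IsAffineBelow n e)
    (he' : IsAffineBelow n e') {p q : Fin m} (hpq : p ≠ q) (hp : p ∈ S \ T) (hq : q ∈ S \ T)
    (h : e * A = e' * C) : e * A = 0 := by
  rcases affine_mul_orbitFull hA n he with h0 | ⟨S', hS, -, hS'⟩
  · exact h0
  rcases affine_mul_orbitFull hC n he' with h0 | ⟨T', -, hT, hT'⟩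
  · rw [h, h0]
  have hsub : S \ T ⊆ T' \ T :=
    Finset.sdiff_subset_sdiff (hS.trans (subset_of_mem_orbitFull hS' (h ▸ hT'))) subset_rfl
  exact absurd (Finset.card_le_one.mp hT p (hsub hp) q (hsub hq)) hpq

theorem ne_add_of_mem_orbitFull {S T : Finset (Fin m)} {A G G' : BF m}
    (hA : A ∈ orbitFull S) (hG : G ∈ orbitFull T) (hG' : G' ∈ orbitFull T) {q : Fin m}
    (hq : q ∈ S \ T) (hlt : ∀ j ∈ T \ S, j < q) : A ≠ G + G' := by
  intro h
  induction S using Finset.strongInduction generalizing T A G G' with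
  | H S ih =>
    obtain ⟨hqS, hqT⟩ := Finset.mem_sdiff.mp hq
    obtain ⟨t, htS, hlS⟩ : ∃ t ∈ S, ∀ i ∈ S, i ≤ t :=
      ⟨_, Finset.max'_mem _ ⟨q, hqS⟩, fun i hi => Finset.le_max' _ i hi⟩
    have hlT : ∀ i ∈ T, i ≤ t := fun i hi => by
      by_cases hiS : i ∈ S
      · exact hlS i hiS
      · exact (hlt i (Finset.mem_sdiff.mpr ⟨hi, hiS⟩)).le.trans (hlS q hqS)
    obtain ⟨-, A₁, -, hA₁, -, hdA⟩ := exists_lead_mul hA htS hlS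
    rw [h, deriv₂_add] at hdA
    by_cases htT : t ∈ T
    · obtain ⟨-, C, -, hC, -, hdC⟩ := exists_lead_mul hG htT hlT
      obtain ⟨-, C', -, hC', -, hdC'⟩ := exists_lead_mul hG' htT hlT
      rw [hdC, hdC'] at hdA
      have hqt : q ≠ t := fun h => hqT (h ▸ htT)
      refine ih _ (Finset.erase_ssubset htS) hA₁ hC hC' ?_ ?_ hdA.symm
      · simp [hqt, hqS, hqT]
      · intro j hj
        simp only [Finset.mem_sdiff, Finset.mem_erase, not_and] at hj
        exact hlt j (Finset.mem_sdiff.mpr ⟨hj.1.2, hj.2 hj.1.1⟩)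
    · have hlt' : ∀ i ∈ T, i < t := fun i hi =>
        lt_of_le_of_ne (hlT i hi) (ne_of_mem_of_not_mem hi htT)
      rw [deriv₂_eq_zero hG hlt', deriv₂_eq_zero hG' hlt', add_zero] at hdA
      exact zero_notMem_orbitFull _ (hdA ▸ hA₁)

/-- A sum of elements of two orbits determines its summands when two variables of
`S \ T` lie above all of `T \ S`. -/
theorem orbitFull_add_injective {S T : Finset (Fin m)} {F F' G G' : BF m}
    (hF : F ∈ orbitFull S) (hF' : F' ∈ orbitFull S) (hG : G ∈ orbitFull T)
    (hG' : G' ∈ orbitFull T) {p q : Fin m} (hpq : q < p) (hp : p ∈ S \ T) (hq : q ∈ S \ T)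
    (hlt : ∀ j ∈ T \ S, j < q) (h : F + F' = G + G') : F = F' ∧ G = G' := by
  suffices hFF : F + F' = 0 from
    ⟨eq_of_add_eq_zero_bf hFF, eq_of_add_eq_zero_bf (h ▸ hFF)⟩
  induction S using Finset.strongInduction generalizing T F F' G G' with
  | H S ih =>
    obtain ⟨hqS, hqT⟩ := Finset.mem_sdiff.mp hq
    obtain ⟨hpS, hpT⟩ := Finset.mem_sdiff.mp hp
    obtain ⟨t, htS, hlS⟩ : ∃ t ∈ S, ∀ i ∈ S, i ≤ t :=
      ⟨_, Finset.max'_mem _ ⟨q, hqS⟩, fun i hi => Finset.le_max' _ i hi⟩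
    have hlT : ∀ i ∈ T, i ≤ t := fun i hi => by
      by_cases hiS : i ∈ S
      · exact hlS i hiS
      · exact (hlt i (Finset.mem_sdiff.mpr ⟨hi, hiS⟩)).le.trans (hlS q hqS)
    have hqt : q ≠ t := (hpq.trans_le (hlS p hpS)).ne
    obtain ⟨f, A, hf, hA, rfl, hdA⟩ := exists_lead_mul hF htS hlS
    obtain ⟨f', A', hf', hA', rfl, hdA'⟩ := exists_lead_mul hF' htS hlS
    have hd := congrArg (deriv₂ t) h
    rw [deriv₂_add, deriv₂_add, hdA, hdA'] at hd
    have hqE : q ∈ S.erase t := Finset.mem_erase.mpr ⟨hqt, hqS⟩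
    by_cases htT : t ∈ T
    · obtain ⟨g, C, hg, hC, rfl, hdC⟩ := exists_lead_mul hG htT hlT
      obtain ⟨g', C', hg', hC', rfl, hdC'⟩ := exists_lead_mul hG' htT hlT
      rw [hdC, hdC'] at hd
      have hpt : p ≠ t := fun h => hpT (h ▸ htT)
      have hpE : p ∈ S.erase t \ T.erase t := by simp [hpt, hpS, hpT]
      have hqE' : q ∈ S.erase t \ T.erase t := by simp [hqt, hqS, hqT]
      have hAA : A + A' = 0 := by
        refine ih _ (Finset.erase_ssubset htS) hA hA' hC hC' hpE hqE' ?_ hd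
        intro j hj
        simp only [Finset.mem_sdiff, Finset.mem_erase, not_and] at hj
        exact hlt j (Finset.mem_sdiff.mpr ⟨hj.1.2, hj.2 hj.1.1⟩)
      obtain rfl := eq_of_add_eq_zero_bf hAA
      obtain rfl := eq_of_add_eq_zero_bf (hd ▸ hAA)
      rw [← add_mul, ← add_mul] at h
      rw [← add_mul]
      exact affine_mul_eq_zero_of_eq hA hC (hf.add_isAffineBelow hf')
        (hg.add_isAffineBelow hg') hpq.ne' hpE hqE' h
    · have hlt' : ∀ i ∈ T, i < t := fun i hi =>
        lt_of_le_of_ne (hlT i hi) (ne_of_mem_of_not_mem hi htT)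
      rw [deriv₂_eq_zero hG hlt', deriv₂_eq_zero hG' hlt', add_zero] at hd
      obtain rfl := eq_of_add_eq_zero_bf hd
      rw [← add_mul] at h ⊢
      rcases affine_mul_orbitFull hA _ (hf.add_isAffineBelow hf') with h0 | ⟨S', hS, -, hS'⟩
      · exact h0
      · refine absurd h (ne_add_of_mem_orbitFull hS' hG hG'
          (Finset.mem_sdiff.mpr ⟨hS hqE, hqT⟩) fun j hj => ?_)
        obtain ⟨hjT, hjS'⟩ := Finset.mem_sdiff.mp hj
        refine hlt j (Finset.mem_sdiff.mpr ⟨hjT, fun hjS => hjS' (hS ?_)⟩)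
        exact Finset.mem_erase.mpr ⟨ne_of_mem_of_not_mem hjT htT, hjS⟩

theorem ncard_orbitFull_add {S T : Finset (Fin m)} {p q : Fin m} (hpq : q < p)
    (hp : p ∈ S \ T) (hq : q ∈ S \ T) (hlt : ∀ j ∈ T \ S, j < q) :
    (orbitFull S + orbitFull T).ncard = (orbitFull S).ncard * (orbitFull T).ncard := by
  rw [← Set.ncard_prod, ← Set.add_image_prod]
  refine Set.InjOn.ncard_image ?_
  rintro ⟨F, G⟩ ⟨hF, hG⟩ ⟨F', G'⟩ ⟨hF', hG'⟩ h
  have h' : F + F' = G + G' := by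
    refine eq_of_add_eq_zero_bf ?_
    have h : F + G = F' + G' := h
    rw [add_add_add_comm, h, add_self_bf]
  obtain ⟨rfl, rfl⟩ := orbitFull_add_injective hF hF' hG hG' hpq hp hq hlt h'
  rfl

theorem Finset.le_orderEmbOfFin_last {α : Type*} [LinearOrder α] {X : Finset α} {s : ℕ}
    (hX : X.card = s) (hs : s - 1 < s) {j : α} (hj : j ∈ X) :
    j ≤ X.orderEmbOfFin hX ⟨s - 1, hs⟩ := by
  rw [← Finset.mem_coe, ← Finset.range_orderEmbOfFin X hX] at hj
  obtain ⟨l, rfl⟩ := hj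
  exact (X.orderEmbOfFin hX).monotone (Fin.le_def.mpr (Nat.le_sub_one_of_lt l.2))

end Orbits

/-- with `S_h = S_f ∩ S_g`, `s = r − |S_h| ≥ 2`, and the top-two
condition on the increasing enumerations of `S_f \ S_h` and `S_g \ S_h`, the
Minkowski sum of the full orbits has cardinality the product of the
cardinalities. -/
theorem stmt3 (m r s : ℕ) (I : Finset (Finset (Fin m))) (hI : Decreasing I)
    (hmax : ∀ T ∈ I, T.card ≤ r) (hex : ∃ T ∈ I, T.card = r)
    (Sf Sg : Finset (Fin m)) (hf : Sf ∈ I) (hfc : Sf.card = r)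
    (hg : Sg ∈ I) (hgc : Sg.card = r)
    (hs : s = r - (Sf ∩ Sg).card) (hs2 : 2 ≤ s)
    (hA : (Sf \ (Sf ∩ Sg)).card = s) (hB : (Sg \ (Sf ∩ Sg)).card = s)
    (hcond :
      ((Sf \ (Sf ∩ Sg)).orderEmbOfFin hA ⟨s - 1, by omega⟩ >
          (Sf \ (Sf ∩ Sg)).orderEmbOfFin hA ⟨s - 2, by omega⟩ ∧
        (Sf \ (Sf ∩ Sg)).orderEmbOfFin hA ⟨s - 2, by omega⟩ >
          (Sg \ (Sf ∩ Sg)).orderEmbOfFin hB ⟨s - 1, by omega⟩) ∨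
      ((Sg \ (Sf ∩ Sg)).orderEmbOfFin hB ⟨s - 1, by omega⟩ >
          (Sg \ (Sf ∩ Sg)).orderEmbOfFin hB ⟨s - 2, by omega⟩ ∧
        (Sg \ (Sf ∩ Sg)).orderEmbOfFin hB ⟨s - 2, by omega⟩ >
          (Sf \ (Sf ∩ Sg)).orderEmbOfFin hA ⟨s - 1, by omega⟩)) :
    (orbitFull Sf + orbitFull Sg).ncard =
      (orbitFull Sf).ncard * (orbitFull Sg).ncard := by
  have hSf : Sf \ (Sf ∩ Sg) = Sf \ Sg := Finset.sdiff_inter_self_left Sf Sg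
  have hSg : Sg \ (Sf ∩ Sg) = Sg \ Sf := Finset.sdiff_inter_self_right Sg Sf
  rcases hcond with ⟨h1, h2⟩ | ⟨h1, h2⟩
  · exact ncard_orbitFull_add h1 (hSf ▸ Finset.orderEmbOfFin_mem _ hA _)
      (hSf ▸ Finset.orderEmbOfFin_mem _ hA _)
      fun j hj => (Finset.le_orderEmbOfFin_last hB _ (hSg.symm ▸ hj)).trans_lt h2
  · rw [add_comm, mul_comm]
    exact ncard_orbitFull_add h1 (hSg ▸ Finset.orderEmbOfFin_mem _ hB _)
      (hSg ▸ Finset.orderEmbOfFin_mem _ hB _)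
      fun j hj => (Finset.le_orderEmbOfFin_last hA _ (hSf.symm ▸ hj)).trans_lt h2
end

section
/- Let I be a decreasing family of finsets of Fin m with r = max_{T ∈ I} |T|, let S_f, S_g ∈ I_r, and assume S_h := S_f ∩ S_g ≠ ∅. Let (B,ε), (B′,ε′) ∈ LTA(m,2)_{S_f} and (A,γ), (A′,γ′) ∈ LTA(m,2)_{S_g}. If (B,ε)·x^{S_f} ≠ (B′,ε′)·x^{S_f}, (A,γ)·x^{S_g} ≠ (A′,γ′)·x^{S_g}, and (B,ε)·x^{S_f} + (B′,ε′)·x^{S_f} = (A,γ)·x^{S_g} + (A′,γ′)·x^{S_g}, then (B,ε)·x^{S_f\S_h} + (B′,ε′)·x^{S_f\S_h} = (A,γ)·x^{S_g\S_h} + (A′,γ′)·x^{S_g\S_h}. -/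
open Pointwise

/-- On `LTA(m,2)_S`, the discrete derivative in direction `h ∈ T ⊆ S` of the image of `x^T`
removes the factor indexed by `h`. -/
theorem act_add_single_add_act {m : ℕ} {S T : Finset (Fin m)}
    {p : (Fin m → Fin m → ZMod 2) × (Fin m → ZMod 2)} (hp : p ∈ LTAsub S) (hTS : T ⊆ S)
    {h : Fin m} (hT : h ∈ T) (v : Fin m → ZMod 2) :
    act p.1 p.2 T (v + Pi.single h 1) + act p.1 p.2 T v = act p.1 p.2 (T.erase h) v := by
  have hB : ∀ i, p.1 i h = 0 := fun i => by
    by_contra hne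
    exact (hp.2 i h hne).2.2 (hTS hT)
  have hsum : ∀ i, ∑ j, p.1 i j * (v + Pi.single h 1 : Fin m → ZMod 2) j =
      ∑ j, p.1 i j * v j := fun i => by
    refine Finset.sum_congr rfl fun j _ => ?_
    rcases eq_or_ne j h with rfl | hj
    · simp [hB]
    · simp [hj]
  have herase : act p.1 p.2 (T.erase h) (v + Pi.single h 1) = act p.1 p.2 (T.erase h) v := by
    refine Finset.prod_congr rfl fun i hi => ?_
    rw [hsum, Pi.add_apply, Pi.single_eq_of_ne (Finset.ne_of_mem_erase hi), add_zero]
  have hsplit : ∀ w, act p.1 p.2 T w =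
      (w h + (∑ j, p.1 h j * w j) + p.2 h) * act p.1 p.2 (T.erase h) w :=
    fun w => (Finset.mul_prod_erase T _ hT).symm
  rw [hsplit, hsplit v, herase, hsum, Pi.add_apply, Pi.single_eq_same]
  linear_combination (v h + (∑ j, p.1 h j * v j) + p.2 h) * act p.1 p.2 (T.erase h) v *
    (CharTwo.two_eq_zero : (2 : ZMod 2) = 0)

/-- A collision between sums of two orbit elements persists after removing any set of common
indices. -/
theorem act_sdiff_add_act_sdiff {m : ℕ} {S T U : Finset (Fin m)}
    {p p' q q' : (Fin m → Fin m → ZMod 2) × (Fin m → ZMod 2)}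
    (hp : p ∈ LTAsub S) (hp' : p' ∈ LTAsub S) (hq : q ∈ LTAsub T) (hq' : q' ∈ LTAsub T)
    (heq : act p.1 p.2 S + act p'.1 p'.2 S = act q.1 q.2 T + act q'.1 q'.2 T)
    (hU : U ⊆ S ∩ T) :
    act p.1 p.2 (S \ U) + act p'.1 p'.2 (S \ U) =
      act q.1 q.2 (T \ U) + act q'.1 q'.2 (T \ U) := by
  induction U using Finset.induction_on with
  | empty => simpa using heq
  | insert h U hhU ih =>
    obtain ⟨hh, hU⟩ := Finset.insert_subset_iff.mp hU
    obtain ⟨hS, hT⟩ := Finset.mem_inter.mp hh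
    have ih := ih hU
    have hS' : h ∈ S \ U := Finset.mem_sdiff.mpr ⟨hS, hhU⟩
    have hT' : h ∈ T \ U := Finset.mem_sdiff.mpr ⟨hT, hhU⟩
    rw [Finset.sdiff_insert, Finset.sdiff_insert]
    funext v
    have hv := congrFun ih v
    have hvh := congrFun ih (v + Pi.single h 1)
    simp only [Pi.add_apply (f := act _ _ _)] at hv hvh ⊢
    rw [← act_add_single_add_act hp Finset.sdiff_subset hS',
      ← act_add_single_add_act hp' Finset.sdiff_subset hS',
      ← act_add_single_add_act hq Finset.sdiff_subset hT',
      ← act_add_single_add_act hq' Finset.sdiff_subset hT']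
    linear_combination hv + hvh

/-- a collision between sums of two orbit elements restricts to the
complements of the common part `S_h = S_f ∩ S_g`. -/
theorem stmt6 (m r : ℕ) (I : Finset (Finset (Fin m))) (hI : Decreasing I)
    (hmax : ∀ T ∈ I, T.card ≤ r) (hex : ∃ T ∈ I, T.card = r)
    (Sf Sg : Finset (Fin m)) (hf : Sf ∈ I) (hfc : Sf.card = r)
    (hg : Sg ∈ I) (hgc : Sg.card = r)
    (hne : Sf ∩ Sg ≠ ∅)
    (p p' : (Fin m → Fin m → ZMod 2) × (Fin m → ZMod 2))
    (q q' : (Fin m → Fin m → ZMod 2) × (Fin m → ZMod 2))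
    (hp : p ∈ LTAsub Sf) (hp' : p' ∈ LTAsub Sf)
    (hq : q ∈ LTAsub Sg) (hq' : q' ∈ LTAsub Sg)
    (h1 : act p.1 p.2 Sf ≠ act p'.1 p'.2 Sf)
    (h2 : act q.1 q.2 Sg ≠ act q'.1 q'.2 Sg)
    (h3 : act p.1 p.2 Sf + act p'.1 p'.2 Sf =
      act q.1 q.2 Sg + act q'.1 q'.2 Sg) :
    act p.1 p.2 (Sf \ (Sf ∩ Sg)) + act p'.1 p'.2 (Sf \ (Sf ∩ Sg)) =
      act q.1 q.2 (Sg \ (Sf ∩ Sg)) + act q'.1 q'.2 (Sg \ (Sf ∩ Sg)) := by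
  exact act_sdiff_add_act_sdiff hp hp' hq hq' h3 subset_rfl
end

section
/- Let I be a decreasing family of finsets of Fin m with r = max_{T ∈ I} |T|, let S_f, S_g ∈ I_r, and set S_h = S_f ∩ S_g with |S_h| ≤ r − 2. Then |LTA(m,2)_{S_h}·x^{S_h} · (LTA(m,2)_{S_f}·x^{S_f\S_h} + LTA(m,2)_{S_g}·x^{S_g\S_h})| = |LTA(m,2)_{S_h}·x^{S_h}| · |LTA(m,2)_{S_f}·x^{S_f\S_h} + LTA(m,2)_{S_g}·x^{S_g\S_h}|, where + and · denote the Minkowski sum and Minkowski product of sets of Boolean functions. -/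
open Pointwise

/-- The function `v ↦ v i + ∑ j, B i j * v j + ε i`, one factor of `act B ε T`. -/
def affineRow {m : ℕ} (B : Fin m → Fin m → ZMod 2) (ε : Fin m → ZMod 2) (i : Fin m) : BF m :=
  fun v => v i + (∑ j, B i j * v j) + ε i

/-- Affine functions over `ZMod 2`, characterised by preserving sums of three vectors. -/
def IsAffineFun {m : ℕ} (f : BF m) : Prop :=
  ∀ x y z, f (x + y + z) = f x + f y + f z

lemma ZMod.ne_zero_iff_eq_one_of_two (a : ZMod 2) : a ≠ 0 ↔ a = 1 := by
  revert a; decide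

lemma ZMod.eq_of_eq_one_iff {a b : ZMod 2} (h : a = 1 ↔ b = 1) : a = b := by
  revert a b; decide

lemma ZMod.prod_eq_one_iff_of_two {ι : Type*} (T : Finset ι) (f : ι → ZMod 2) :
    ∏ i ∈ T, f i = 1 ↔ ∀ i ∈ T, f i = 1 := by
  simp_rw [← ZMod.ne_zero_iff_eq_one_of_two]
  exact Finset.prod_ne_zero_iff

lemma isAffineFun_affineRow {m : ℕ} (B : Fin m → Fin m → ZMod 2) (ε : Fin m → ZMod 2)
    (i : Fin m) : IsAffineFun (affineRow B ε i) := by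
  intro x y z
  have h3 : ε i = ε i + ε i + ε i := by
    rw [CharTwo.add_self_eq_zero, zero_add]
  simp only [affineRow, Pi.add_apply, mul_add, Finset.sum_add_distrib]
  linear_combination h3

lemma IsAffineFun.sub {m : ℕ} {f g : BF m} (hf : IsAffineFun f) (hg : IsAffineFun g) :
    IsAffineFun (f - g) := by
  intro x y z
  simp only [Pi.sub_apply, hf x y z, hg x y z]
  ring

/-- An affine function vanishing wherever `x^A ≠ x^B` vanishes at the indicator of `A` and does not
depend on the variables outside `A`. -/
lemma IsAffineFun.apply_single_of_notMem {m : ℕ} {A B : Finset (Fin m)} (hAB : Disjoint A B)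
    (hB : 2 ≤ B.card) {f : BF m} (hf : IsAffineFun f)
    (h : ∀ w, mono A w ≠ mono B w → f w = 0) :
    f (fun i => if i ∈ A then 1 else 0) = 0 ∧ ∀ k ∉ A, f (Pi.single k 1) = f 0 := by
  have key : ∀ k ∉ A, ∀ c : ZMod 2,
      f ((fun i => if i ∈ A then 1 else 0) + Pi.single k c) = 0 := by
    intro k hk c
    apply h
    obtain ⟨b, hb, hbk⟩ := Finset.exists_mem_ne (by omega : 1 < B.card) k
    have hbA : b ∉ A := fun hA => Finset.disjoint_left.mp hAB hA hb
    have h1 : mono A ((fun i => if i ∈ A then 1 else 0) + Pi.single k c) = 1 := by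
      refine (ZMod.prod_eq_one_iff_of_two _ _).mpr fun i hi => ?_
      have : i ≠ k := fun e => hk (e ▸ hi)
      simp [hi, this]
    have h0 : mono B ((fun i => if i ∈ A then 1 else 0) + Pi.single k c) = 0 :=
      Finset.prod_eq_zero hb (by simp [hbA, hbk])
    rw [h1, h0]
    exact one_ne_zero
  obtain ⟨b, hb⟩ := Finset.card_pos.mp (by omega : 0 < B.card)
  have hbA : b ∉ A := fun hA => Finset.disjoint_left.mp hAB hA hb
  have h0 : f (fun i => if i ∈ A then 1 else 0) = 0 := by
    simpa using key b hbA 0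
  refine ⟨h0, fun k hk => ?_⟩
  have h1 := key k hk 1
  have h2 := hf (fun i => if i ∈ A then 1 else 0) (Pi.single k 1) 0
  rw [add_zero, h1, h0, zero_add] at h2
  exact CharTwo.add_eq_zero.mp h2.symm

lemma IsAffineFun.eq_zero_of_mono_ne {m : ℕ} {A B : Finset (Fin m)} (hAB : Disjoint A B)
    (hA : 2 ≤ A.card) (hB : 2 ≤ B.card) {f : BF m} (hf : IsAffineFun f)
    (h : ∀ w, mono A w ≠ mono B w → f w = 0) : f = 0 := by
  obtain ⟨h0, h1⟩ := hf.apply_single_of_notMem hAB hB h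
  obtain ⟨-, h2⟩ := hf.apply_single_of_notMem hAB.symm hA fun w hw => h w hw.symm
  have hs : ∀ k, f (Pi.single k 1) = f 0 := fun k =>
    if hk : k ∈ A then h2 k (Finset.disjoint_left.mp hAB hk) else h1 k hk
  let g : (Fin m → ZMod 2) →+ ZMod 2 := AddMonoidHom.mk' (fun x => f x + f 0) fun x y => by
    have := hf x y 0
    rw [add_zero] at this
    rw [this]
    ring
  have hg : g = 0 := by
    refine AddMonoidHom.functions_ext _ _ _ fun i x => ?_
    obtain rfl | rfl : x = 0 ∨ x = 1 := by revert x; decide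
    · simp
    · change f (Pi.single i 1) + f 0 = 0
      rw [hs, CharTwo.add_self_eq_zero]
  have hc : ∀ x, f x = f 0 := fun x => CharTwo.add_eq_zero.mp (DFunLike.congr_fun hg x)
  funext x
  rw [hc, ← hc, h0, Pi.zero_apply]

/-- The affine map with unitriangular linear part `1 + B` is bijective. -/
lemma bijective_affineRow {m : ℕ} {B : Fin m → Fin m → ZMod 2} (ε : Fin m → ZMod 2)
    (hB : ∀ i j, B i j ≠ 0 → j < i) :
    Function.Bijective fun (v : Fin m → ZMod 2) i => affineRow B ε i v := by
  refine Finite.injective_iff_bijective.mp fun v w hvw => funext fun i => ?_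
  induction i using WellFoundedLT.induction with
  | ind i ih =>
    have hi : affineRow B ε i v = affineRow B ε i w := congrFun hvw i
    have hs : ∑ j, B i j * v j = ∑ j, B i j * w j := Finset.sum_congr rfl fun j _ => by
      by_cases h : B i j = 0
      · simp [h]
      · rw [ih j (hB i j h)]
    simpa [affineRow, hs] using hi

lemma IsAffineFun.eq_zero_of_act_ne {m : ℕ} {Sf Sg A B : Finset (Fin m)}
    (hAB : Disjoint A B) (hA : 2 ≤ A.card) (hB : 2 ≤ B.card)
    {p q : (Fin m → Fin m → ZMod 2) × (Fin m → ZMod 2)} (hp : p ∈ LTAsub Sf) (hq : q ∈ LTAsub Sg)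
    {f : BF m} (hf : IsAffineFun f)
    (h : ∀ v, act p.1 p.2 A v ≠ act q.1 q.2 B v → f v = 0) : f = 0 := by
  let M : Fin m → Fin m → ZMod 2 := fun i j => if i ∈ A then p.1 i j else q.1 i j
  let ε : Fin m → ZMod 2 := fun i => if i ∈ A then p.2 i else q.2 i
  have hM : ∀ i j, M i j ≠ 0 → j < i := by
    intro i j hij
    by_cases hi : i ∈ A
    · exact (hp.2 i j (by simpa [M, hi] using hij)).2.1
    · exact (hq.2 i j (by simpa [M, hi] using hij)).2.1
  let e := Equiv.ofBijective _ (bijective_affineRow ε hM)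
  have he : ∀ v i, e v i = affineRow M ε i v := fun _ _ => rfl
  have hPA : ∀ v, act p.1 p.2 A v = mono A (e v) := fun v =>
    Finset.prod_congr rfl fun i hi => by simp [he, affineRow, M, ε, hi]
  have hQB : ∀ v, act q.1 q.2 B v = mono B (e v) := fun v =>
    Finset.prod_congr rfl fun i hi => by
      simp [he, affineRow, M, ε, Finset.disjoint_right.mp hAB hi]
  have hfe : IsAffineFun (f ∘ e.symm) := by
    intro x y z
    have hadd : e.symm (x + y + z) = e.symm x + e.symm y + e.symm z := by
      rw [e.symm_apply_eq]
      funext i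
      rw [he, isAffineFun_affineRow M ε i]
      simp only [← he, Equiv.apply_symm_apply, Pi.add_apply]
    simp only [Function.comp_apply, hadd]
    exact hf _ _ _
  have h0 := hfe.eq_zero_of_mono_ne hAB hA hB fun w hw =>
    h _ (by rwa [hPA, hQB, e.apply_symm_apply])
  funext v
  simpa using congrFun h0 (e v)

lemma act_congr {m : ℕ} {S R T : Finset (Fin m)} (hRS : R ⊆ S) (hRT : Disjoint R T)
    {p : (Fin m → Fin m → ZMod 2) × (Fin m → ZMod 2)} (hp : p ∈ LTAsub S)
    {v w : Fin m → ZMod 2} (hvw : ∀ j ∉ R, v j = w j) :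
    act p.1 p.2 T v = act p.1 p.2 T w := by
  refine Finset.prod_congr rfl fun i hi => ?_
  rw [hvw i (Finset.disjoint_right.mp hRT hi), Finset.sum_congr rfl fun j _ => ?_]
  by_cases h : p.1 i j = 0
  · simp [h]
  · rw [hvw j fun hj => (hp.2 i j h).2.2 (hRS hj)]

/-- For `p ∈ LTA(m,2)_S`, the variables in `S` can be adjusted so that `p·x^S` takes value `1`. -/
lemma exists_act_eq_one {m : ℕ} {S : Finset (Fin m)}
    {p : (Fin m → Fin m → ZMod 2) × (Fin m → ZMod 2)} (hp : p ∈ LTAsub S) (v : Fin m → ZMod 2) :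
    ∃ w, (∀ j ∉ S, w j = v j) ∧ act p.1 p.2 S w = 1 := by
  let w : Fin m → ZMod 2 := fun i => if i ∈ S then 1 + ((∑ j, p.1 i j * v j) + p.2 i) else v i
  have hw : ∀ j ∉ S, w j = v j := fun j hj => if_neg hj
  refine ⟨w, hw, (ZMod.prod_eq_one_iff_of_two _ _).mpr fun i hi => ?_⟩
  have hs : ∑ j, p.1 i j * w j = ∑ j, p.1 i j * v j := Finset.sum_congr rfl fun j _ => by
    by_cases h : p.1 i j = 0
    · simp [h]
    · rw [hw j (hp.2 i j h).2.2]
  rw [hs, show w i = 1 + ((∑ j, p.1 i j * v j) + p.2 i) from if_pos hi, add_assoc, add_assoc,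
    CharTwo.add_self_eq_zero, add_zero]

/-- For `p, q ∈ LTA(m,2)_S`, the difference of corresponding rows only depends on the variables
outside `S`. -/
lemma affineRow_sub_congr {m : ℕ} {S : Finset (Fin m)}
    {p q : (Fin m → Fin m → ZMod 2) × (Fin m → ZMod 2)} (hp : p ∈ LTAsub S) (hq : q ∈ LTAsub S)
    (i : Fin m) {v w : Fin m → ZMod 2} (hvw : ∀ j ∉ S, v j = w j) :
    affineRow p.1 p.2 i v - affineRow q.1 q.2 i v =
      affineRow p.1 p.2 i w - affineRow q.1 q.2 i w := by
  have hs : ∀ p ∈ LTAsub S, ∑ j, p.1 i j * v j = ∑ j, p.1 i j * w j := fun p hp =>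
    Finset.sum_congr rfl fun j _ => by
      by_cases h : p.1 i j = 0
      · simp [h]
      · rw [hvw j (hp.2 i j h).2.2]
  simp only [affineRow, hs p hp, hs q hq]
  ring

lemma eq_of_act_mul_eq {m : ℕ} {S : Finset (Fin m)}
    {p q : (Fin m → Fin m → ZMod 2) × (Fin m → ZMod 2)} (hp : p ∈ LTAsub S) {G G' : BF m}
    (hG : ∀ v w, (∀ j ∉ S, v j = w j) → G v = G w)
    (hG' : ∀ v w, (∀ j ∉ S, v j = w j) → G' v = G' w)
    (h : act p.1 p.2 S * G = act q.1 q.2 S * G') {v : Fin m → ZMod 2} (hv : G v = 1) :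
    G' v = 1 ∧ ∃ w, (∀ j ∉ S, w j = v j) ∧ act p.1 p.2 S w = 1 ∧ act q.1 q.2 S w = 1 := by
  obtain ⟨w, hw, h1⟩ := exists_act_eq_one hp v
  have h2 := congrFun h w
  rw [Pi.mul_apply, Pi.mul_apply, h1, hG w v hw, hv, one_mul, eq_comm,
    ← ZMod.ne_zero_iff_eq_one_of_two, mul_ne_zero_iff, ZMod.ne_zero_iff_eq_one_of_two,
    ZMod.ne_zero_iff_eq_one_of_two, hG' w v hw] at h2
  exact ⟨h2.2, w, hw, h1, h2.1⟩

/-- if `S_h = S_f ∩ S_g` has `|S_h| ≤ r − 2`, the Minkowski product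
of `LTA(m,2)_{S_h}·x^{S_h}` with the Minkowski sum of the two orbits has
cardinality the product of the cardinalities. -/
theorem stmt7 (m r : ℕ) (I : Finset (Finset (Fin m))) (hI : Decreasing I)
    (hmax : ∀ T ∈ I, T.card ≤ r) (hex : ∃ T ∈ I, T.card = r)
    (Sf Sg : Finset (Fin m)) (hf : Sf ∈ I) (hfc : Sf.card = r)
    (hg : Sg ∈ I) (hgc : Sg.card = r)
    (hh : (Sf ∩ Sg).card ≤ r - 2) :
    (orbitSub (Sf ∩ Sg) (Sf ∩ Sg) *
        (orbitSub Sf (Sf \ (Sf ∩ Sg)) + orbitSub Sg (Sg \ (Sf ∩ Sg)))).ncard =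
      (orbitSub (Sf ∩ Sg) (Sf ∩ Sg)).ncard *
        (orbitSub Sf (Sf \ (Sf ∩ Sg)) + orbitSub Sg (Sg \ (Sf ∩ Sg))).ncard := by
  set S := Sf ∩ Sg
  have hSf : S ⊆ Sf := Finset.inter_subset_left
  have hSg : S ⊆ Sg := Finset.inter_subset_right
  rcases S.eq_empty_or_nonempty with hS | hS
  · have h1 : orbitSub S S = 1 := by
      rw [hS]
      ext F
      constructor
      · rintro ⟨p, -, rfl⟩
        rfl
      · intro hF
        exact ⟨(0, 0), ⟨fun _ _ => rfl, fun i j h => absurd rfl h⟩, hF⟩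
    rw [h1, one_mul, ← Set.singleton_one, Set.ncard_singleton, one_mul]
  have hScard := hS.card_pos
  have hA : 2 ≤ (Sf \ S).card := by rw [Finset.card_sdiff_of_subset hSf]; omega
  have hB : 2 ≤ (Sg \ S).card := by rw [Finset.card_sdiff_of_subset hSg]; omega
  have hAB : Disjoint (Sf \ S) (Sg \ S) := by
    rw [Finset.disjoint_left]
    intro i hi hi'
    rw [Finset.mem_sdiff] at hi hi'
    exact hi.2 (Finset.mem_inter.mpr ⟨hi.1, hi'.1⟩)
  have hGcongr : ∀ G ∈ orbitSub Sf (Sf \ S) + orbitSub Sg (Sg \ S),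
      ∀ v w, (∀ j ∉ S, v j = w j) → G v = G w := by
    rintro _ ⟨_, ⟨p, hp, rfl⟩, _, ⟨q, hq, rfl⟩, rfl⟩ v w hvw
    exact congrArg₂ (· + ·) (act_congr hSf Finset.disjoint_sdiff hp hvw)
      (act_congr hSg Finset.disjoint_sdiff hq hvw)
  rw [← Set.ncard_prod, ← Set.image_mul_prod]
  refine Set.InjOn.ncard_image ?_
  rintro ⟨_, G⟩ ⟨⟨p, hp, rfl⟩, hG⟩ ⟨_, G'⟩ ⟨⟨q, hq, rfl⟩, hG'⟩ (h : _ * _ = _ * _)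
  have key := fun v (hv : G v = 1) => eq_of_act_mul_eq hp (hGcongr G hG) (hGcongr G' hG') h hv
  have hGG' : G = G' := funext fun v => ZMod.eq_of_eq_one_iff ⟨fun hv => (key v hv).1, fun hv =>
    (eq_of_act_mul_eq hq (hGcongr G' hG') (hGcongr G hG) h.symm hv).1⟩
  have hrow : ∀ i ∈ S, affineRow p.1 p.2 i = affineRow q.1 q.2 i := by
    intro i hi
    rw [← sub_eq_zero]
    obtain ⟨_, ⟨a, ha, rfl⟩, _, ⟨b, hb, rfl⟩, rfl⟩ := hG
    refine ((isAffineFun_affineRow _ _ i).sub (isAffineFun_affineRow _ _ i)).eq_zero_of_act_ne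
      hAB hA hB ha hb fun v hv => ?_
    obtain ⟨-, w, hw, h1, h2⟩ := key v <| (ZMod.ne_zero_iff_eq_one_of_two _).mp fun h0 =>
      hv (CharTwo.add_eq_zero.mp h0)
    have h1' : affineRow p.1 p.2 i w = 1 := (ZMod.prod_eq_one_iff_of_two _ _).mp h1 i hi
    have h2' : affineRow q.1 q.2 i w = 1 := (ZMod.prod_eq_one_iff_of_two _ _).mp h2 i hi
    rw [Pi.sub_apply, ← affineRow_sub_congr hp hq i hw, h1', h2', sub_self]
  refine Prod.ext (funext fun v => ?_) hGG'
  exact Finset.prod_congr rfl fun i hi => congrFun (hrow i hi) v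
end

section
/- Let I be a decreasing family of finsets of Fin m with r = max_{T ∈ I} |T|, let S_f, S_g ∈ I_r, and set S_h = S_f ∩ S_g with |S_h| = r − 1. Assume every element of S_h is smaller than every element of (S_f ∪ S_g) \ S_h. Then |LTA(m,2)_{S_h}·x^{S_h} · (LTA(m,2)_{S_f}·x^{S_f\S_h} + LTA(m,2)_{S_g}·x^{S_g\S_h})| = |LTA(m,2)_{S_h}·x^{S_h}| · |LTA(m,2)_{S_f}·x^{S_f\S_h} + LTA(m,2)_{S_g}·x^{S_g\S_h}|, where + and · denote the Minkowski sum and Minkowski product of sets of Boolean functions. -/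
open Pointwise

/-- The `i`-th affine form of the pair `(B, ε)`, without its leading variable. -/
def affPart {m : ℕ} (B : Fin m → Fin m → ZMod 2) (ε : Fin m → ZMod 2) (i : Fin m) : BF m :=
  fun v => (∑ j, B i j * v j) + ε i

theorem act_apply {m : ℕ} (B : Fin m → Fin m → ZMod 2) (ε : Fin m → ZMod 2)
    (T : Finset (Fin m)) (v : Fin m → ZMod 2) :
    act B ε T v = ∏ i ∈ T, (v i + affPart B ε i v) := by
  simp only [act, affPart, add_assoc]

theorem act_congr_s8 {m : ℕ} {B B' : Fin m → Fin m → ZMod 2} {ε ε' : Fin m → ZMod 2}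
    {T : Finset (Fin m)} (h : ∀ i ∈ T, ∀ v, affPart B ε i v = affPart B' ε' i v) :
    act B ε T = act B' ε' T := by
  funext v
  simp only [act_apply]
  exact Finset.prod_congr rfl fun i hi => by rw [h i hi]

theorem affPart_congr_of_mem_LTAsub {m : ℕ} {S : Finset (Fin m)}
    {p : (Fin m → Fin m → ZMod 2) × (Fin m → ZMod 2)} (hp : p ∈ LTAsub S)
    {v w : Fin m → ZMod 2} (hvw : ∀ j, j ∉ S → w j = v j) (i : Fin m) :
    affPart p.1 p.2 i w = affPart p.1 p.2 i v := by
  unfold affPart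
  congr 1
  refine Finset.sum_congr rfl fun j _ => ?_
  by_cases hB : p.1 i j = 0
  · simp [hB]
  · rw [hvw j (hp.2 i j hB).2.2]

/-- The pairs in `LTAsub S` act freely on `x^S`: the product of the affine forms determines
each of them. -/
theorem affPart_eq_of_act_eq {m : ℕ} {S : Finset (Fin m)}
    {p q : (Fin m → Fin m → ZMod 2) × (Fin m → ZMod 2)}
    (hp : p ∈ LTAsub S) (hq : q ∈ LTAsub S) (h : act p.1 p.2 S = act q.1 q.2 S)
    {i : Fin m} (hi : i ∈ S) (v : Fin m → ZMod 2) :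
    affPart p.1 p.2 i v = affPart q.1 q.2 i v := by
  set w : Fin m → ZMod 2 := fun j => if j ∈ S then 1 + affPart p.1 p.2 j v else v j with hw
  have hwS : ∀ j ∈ S, w j = 1 + affPart p.1 p.2 j v := fun j hj => by simp [hw, hj]
  have hwv : ∀ j, j ∉ S → w j = v j := fun j hj => by simp [hw, hj]
  have hone : act p.1 p.2 S w = 1 := by
    rw [act_apply]
    refine Finset.prod_eq_one fun j hj => ?_
    rw [affPart_congr_of_mem_LTAsub hp hwv, hwS j hj, add_assoc, CharTwo.add_self_eq_zero,
      add_zero]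
  rw [h, act_apply] at hone
  have hne : w i + affPart q.1 q.2 i w ≠ 0 := fun h0 => by
    rw [Finset.prod_eq_zero hi h0] at hone
    exact zero_ne_one hone
  rw [affPart_congr_of_mem_LTAsub hq hwv, hwS i hi] at hne
  generalize affPart p.1 p.2 i v = x at hne ⊢
  generalize affPart q.1 q.2 i v = y at hne ⊢
  decide +revert

theorem Set.ncard_mul_of_unique {α : Type*} [Mul α] {A B : Set α}
    (h : ∀ a ∈ A, ∀ b ∈ B, ∀ a' ∈ A, ∀ b' ∈ B, a * b = a' * b' → a = a' ∧ b = b') :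
    (A * B).ncard = A.ncard * B.ncard := by
  rw [← Set.image_mul_prod, Set.InjOn.ncard_image, Set.ncard_prod]
  rintro ⟨a, b⟩ ⟨ha, hb⟩ ⟨a', b'⟩ ⟨ha', hb'⟩ hab
  obtain ⟨h₁, h₂⟩ := h a ha b hb a' ha' b' hb' hab
  exact Prod.ext h₁ h₂

theorem exists_act_insert {m : ℕ} {S : Finset (Fin m)} {a b : Fin m} (hab : a < b)
    (ha : a ∉ S) (hb : b ∉ S) (hSb : ∀ i ∈ S, i < b) {F G : BF m}
    (hF : F ∈ orbitSub S S)
    (hG : G ∈ orbitSub (insert a S) {a} + orbitSub (insert b S) {b}) :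
    ∃ p ∈ LTAsub (insert b S), F = act p.1 p.2 S ∧ G = act p.1 p.2 {b} := by
  obtain ⟨⟨B, ε⟩, hp, rfl⟩ := hF
  obtain ⟨_, ⟨⟨Bf, εf⟩, hpf, rfl⟩, _, ⟨⟨Bg, εg⟩, hpg, rfl⟩, rfl⟩ := hG
  simp only [LTAsub, Set.mem_ofPred_eq, Finset.mem_insert, not_or] at hp hpf hpg
  refine ⟨(fun i j => if i = b then Bg b j + Bf a j + (if j = a then 1 else 0) else B i j,
    fun i => if i = b then εg b + εf a else ε i), ⟨?_, ?_⟩, ?_, ?_⟩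
  · intro i hi
    rw [Finset.mem_insert, not_or] at hi
    simp [hi.1, hp.1 i hi.2]
  · intro i j hij
    simp only [Finset.mem_insert, not_or] at hij ⊢
    by_cases hib : i = b
    · subst hib
      rw [if_pos rfl] at hij
      by_cases hja : j = a
      · subst hja
        exact ⟨Or.inl rfl, hab, hab.ne, ha⟩
      · by_cases hgj : Bg i j = 0
        · have hfj : Bf a j ≠ 0 := by simpa [hja, hgj] using hij
          obtain ⟨-, h₁, -, h₂⟩ := hpf.2 a j hfj
          exact ⟨Or.inl rfl, h₁.trans hab, (h₁.trans hab).ne, h₂⟩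
        · obtain ⟨-, h₁, h₂⟩ := hpg.2 i j hgj
          exact ⟨Or.inl rfl, h₁, h₂⟩
    · rw [if_neg hib] at hij
      obtain ⟨h₁, h₂, h₃⟩ := hp.2 i j hij
      exact ⟨Or.inr h₁, h₂, (h₂.trans (hSb i h₁)).ne, h₃⟩
  · refine act_congr_s8 fun i hi v => ?_
    have hib : i ≠ b := fun h => hb (h ▸ hi)
    simp [affPart, hib]
  · funext v
    simp only [act, Pi.add_apply, Finset.prod_singleton, if_true, add_mul, ite_mul, one_mul,
      zero_mul, Finset.sum_add_distrib, Finset.sum_ite_eq', Finset.mem_univ]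
    ring

theorem ncard_orbitSub_mul_add {m : ℕ} {S : Finset (Fin m)} {a b : Fin m} (hab : a < b)
    (ha : a ∉ S) (hb : b ∉ S) (hSb : ∀ i ∈ S, i < b) :
    (orbitSub S S * (orbitSub (insert a S) {a} + orbitSub (insert b S) {b})).ncard =
      (orbitSub S S).ncard * (orbitSub (insert a S) {a} + orbitSub (insert b S) {b}).ncard := by
  refine Set.ncard_mul_of_unique fun F hF G hG F' hF' G' hG' h => ?_
  obtain ⟨p, hp, rfl, rfl⟩ := exists_act_insert hab ha hb hSb hF hG
  obtain ⟨q, hq, rfl, rfl⟩ := exists_act_insert hab ha hb hSb hF' hG'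
  have hact : act p.1 p.2 (insert b S) = act q.1 q.2 (insert b S) := by
    funext v
    have hv := congrFun h v
    simp only [Pi.mul_apply, act, Finset.prod_singleton] at hv
    simp only [act, Finset.prod_insert hb]
    rw [mul_comm, hv, mul_comm]
  exact ⟨act_congr_s8 fun i hi => affPart_eq_of_act_eq hp hq hact (Finset.mem_insert_of_mem hi),
    act_congr_s8 fun i hi => affPart_eq_of_act_eq hp hq hact
      (Finset.mem_insert.2 (Or.inl (Finset.mem_singleton.1 hi)))⟩

/-- if `S_h = S_f ∩ S_g` has `|S_h| = r − 1` and every element of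
`S_h` is smaller than every element of `(S_f ∪ S_g) \ S_h`, the Minkowski
product of `LTA(m,2)_{S_h}·x^{S_h}` with the Minkowski sum of the two orbits
has cardinality the product of the cardinalities. -/
theorem stmt8 (m r : ℕ) (I : Finset (Finset (Fin m))) (hI : Decreasing I)
    (hmax : ∀ T ∈ I, T.card ≤ r) (hex : ∃ T ∈ I, T.card = r)
    (Sf Sg : Finset (Fin m)) (hf : Sf ∈ I) (hfc : Sf.card = r)
    (hg : Sg ∈ I) (hgc : Sg.card = r)
    (hh : (Sf ∩ Sg).card = r - 1)
    (hsmall : ∀ i ∈ Sf ∩ Sg, ∀ j ∈ (Sf ∪ Sg) \ (Sf ∩ Sg), i < j) :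
    (orbitSub (Sf ∩ Sg) (Sf ∩ Sg) *
        (orbitSub Sf (Sf \ (Sf ∩ Sg)) + orbitSub Sg (Sg \ (Sf ∩ Sg)))).ncard =
      (orbitSub (Sf ∩ Sg) (Sf ∩ Sg)).ncard *
        (orbitSub Sf (Sf \ (Sf ∩ Sg)) + orbitSub Sg (Sg \ (Sf ∩ Sg))).ncard := by
  rcases Nat.eq_zero_or_pos r with rfl | hr
  · rw [Finset.card_eq_zero] at hfc hgc
    subst hfc hgc
    refine Set.ncard_mul_of_unique ?_
    rintro _ ⟨p, -, rfl⟩ _ ⟨_, ⟨q, -, rfl⟩, _, ⟨s, -, rfl⟩, rfl⟩ _ ⟨p', -, rfl⟩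
      _ ⟨_, ⟨q', -, rfl⟩, _, ⟨s', -, rfl⟩, rfl⟩ -
    exact ⟨rfl, rfl⟩
  obtain ⟨a, ha⟩ : ∃ a, Sf \ (Sf ∩ Sg) = {a} := by
    rw [← Finset.card_eq_one, Finset.card_sdiff_of_subset Finset.inter_subset_left]
    omega
  obtain ⟨b, hb⟩ : ∃ b, Sg \ (Sf ∩ Sg) = {b} := by
    rw [← Finset.card_eq_one, Finset.card_sdiff_of_subset Finset.inter_subset_right]
    omega
  have haf : a ∈ Sf \ (Sf ∩ Sg) := ha ▸ Finset.mem_singleton_self a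
  have hbg : b ∈ Sg \ (Sf ∩ Sg) := hb ▸ Finset.mem_singleton_self b
  have hf_ins : insert a (Sf ∩ Sg) = Sf := by
    rw [Finset.insert_eq, ← ha, Finset.sdiff_union_of_subset Finset.inter_subset_left]
  have hg_ins : insert b (Sf ∩ Sg) = Sg := by
    rw [Finset.insert_eq, ← hb, Finset.sdiff_union_of_subset Finset.inter_subset_right]
  have hS_a : ∀ i ∈ Sf ∩ Sg, i < a := fun i hi => hsmall i hi a <|
    Finset.sdiff_subset_sdiff Finset.subset_union_left le_rfl haf
  have hS_b : ∀ i ∈ Sf ∩ Sg, i < b := fun i hi => hsmall i hi b <|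
    Finset.sdiff_subset_sdiff Finset.subset_union_right le_rfl hbg
  have ha_not := (Finset.mem_sdiff.1 haf).2
  have hb_not := (Finset.mem_sdiff.1 hbg).2
  have hne : a ≠ b := by
    rintro rfl
    exact ha_not (Finset.mem_inter.2 ⟨(Finset.mem_sdiff.1 haf).1, (Finset.mem_sdiff.1 hbg).1⟩)
  rw [ha, hb]
  rcases hne.lt_or_gt with hlt | hlt
  · have key := ncard_orbitSub_mul_add hlt ha_not hb_not hS_b
    rwa [hf_ins, hg_ins] at key
  · have key := ncard_orbitSub_mul_add hlt hb_not ha_not hS_a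
    rwa [hf_ins, hg_ins, add_comm (orbitSub Sg {b})] at key
end
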